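/- arXiv:2105.12520 — 7 statements merged into one kernel-verified Lean document; each statement's English description precedes it below -/
import Mathlib

section
/- Let q be a prime power and n a positive integer, and let U and V be Sidon spaces in F_{q^n}. Suppose that (1) the subspace (U+V)^2 decomposes as the internal direct sum U^2 ⊕ UV ⊕ V^2, and (2) dim_{F_q}(U ∩ αV) ≤ 1 for every α ∈ F_{q^n}^*. Then U + V is also a Sidon space. -/
open Submodule Pointwise

set_option maxHeartbeats 1000000
set_option synthInstance.maxHeartbeats 400000

/-- An `F`-subspace `V` of a field `K` is a *Sidon space* if for all nonzero
`a, b, c, d ∈ V` with `a * b = c * d` one has `{aF, bF} = {cF, dF}` (as a pair of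
one-dimensional `F`-subspaces). -/
def IsSidonSpace {K : Type*} [Field K] (F : Subfield K) (V : Submodule F K) : Prop :=
  ∀ a ∈ V, ∀ b ∈ V, ∀ c ∈ V, ∀ d ∈ V,
    a ≠ 0 → b ≠ 0 → c ≠ 0 → d ≠ 0 → a * b = c * d →
    ({Submodule.span F {a}, Submodule.span F {b}} : Set (Submodule F K)) =
      {Submodule.span F {c}, Submodule.span F {d}}

/-- If the products `(u₁ + X v₁)(u₂ + X v₂)` and `(u₃ + X v₃)(u₄ + X v₄)` of linear polynomials
agree, then the factor `u₁ + X v₁` is proportional to one of the factors on the right. -/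
theorem proportional_of_mul_eq_mul {K : Type*} [Field K] {u₁ v₁ u₂ v₂ u₃ v₃ u₄ v₄ : K}
    (hu : u₁ * u₂ = u₃ * u₄) (hv : v₁ * v₂ = v₃ * v₄)
    (huv : u₁ * v₂ + u₂ * v₁ = u₃ * v₄ + u₄ * v₃) :
    u₁ * v₃ = u₃ * v₁ ∨ u₁ * v₄ = u₄ * v₁ := by
  have h : (u₁ * v₃ - u₃ * v₁) * (u₁ * v₄ - u₄ * v₁) = 0 := by
    linear_combination (-u₁ ^ 2) * hv + u₁ * v₁ * huv - v₁ ^ 2 * hu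
  rcases mul_eq_zero.mp h with h | h
  · exact Or.inl (sub_eq_zero.mp h)
  · exact Or.inr (sub_eq_zero.mp h)

/-- If the linear polynomial `u₁ + X v₁` is proportional to `u₃ + X v₃`, then the ratio is a
scalar, which is also the ratio of the two complementary factors. -/
theorem exists_ratio_of_mul_eq_mul {K : Type*} [Field K] {u₁ v₁ u₂ v₂ u₃ v₃ u₄ v₄ : K}
    (hu : u₁ * u₂ = u₃ * u₄) (hv : v₁ * v₂ = v₃ * v₄)
    (huv : u₁ * v₂ + u₂ * v₁ = u₃ * v₄ + u₄ * v₃) (h : u₁ * v₃ = u₃ * v₁)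
    (h₁ : u₁ + v₁ ≠ 0) (h₃ : u₃ + v₃ ≠ 0) :
    ∃ k : K, k ≠ 0 ∧ u₃ = k * u₁ ∧ v₃ = k * v₁ ∧ u₂ = k * u₄ ∧ v₂ = k * v₄ := by
  obtain ⟨k, rfl, rfl⟩ : ∃ k : K, u₃ = k * u₁ ∧ v₃ = k * v₁ := by
    by_cases hu₁ : u₁ = 0
    · subst hu₁
      have hv₁ : v₁ ≠ 0 := by simpa using h₁
      exact ⟨v₃ / v₁, by simpa [hv₁] using h, by field_simp⟩
    · exact ⟨u₃ / u₁, by field_simp, by field_simp; linear_combination h⟩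
  refine ⟨k, fun hk => h₃ (by simp [hk]), rfl, rfl, ?_⟩
  by_cases hu₁ : u₁ = 0
  · subst hu₁
    have hv₁ : v₁ ≠ 0 := by simpa using h₁
    exact ⟨mul_left_cancel₀ hv₁ (by linear_combination huv),
      mul_left_cancel₀ hv₁ (by linear_combination hv)⟩
  · have hu₂ : u₂ = k * u₄ := mul_left_cancel₀ hu₁ (by linear_combination hu)
    exact ⟨hu₂, mul_left_cancel₀ hu₁ (by linear_combination huv - v₁ * hu₂)⟩

/-- If every intersection `U ⊓ αV` has dimension at most one, then a common ratio of a pair of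
elements of `U` and a pair of elements of `V` lies in the base field. -/
theorem ratio_mem_of_finrank_inf_smul_le_one {K : Type*} [Field K] [Finite K] {F : Subfield K}
    {U V : Submodule F K}
    (h : ∀ α : K, α ≠ 0 → Module.finrank F ↥(U ⊓ α • V) ≤ 1)
    {k x z : K} (hx : x ∈ U) (hkx : k * x ∈ U) (hz : z ∈ V) (hkz : k * z ∈ V)
    (hx₀ : x ≠ 0) (hz₀ : z ≠ 0) : k ∈ F := by
  have hα : x / z ≠ 0 := div_ne_zero hx₀ hz₀
  have hx' : x ∈ U ⊓ (x / z) • V :=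
    ⟨hx, (Submodule.mem_smul_pointwise_iff_exists _ _ _).mpr
      ⟨z, hz, by simp only [smul_eq_mul]; field_simp⟩⟩
  have hkx' : k * x ∈ U ⊓ (x / z) • V :=
    ⟨hkx, (Submodule.mem_smul_pointwise_iff_exists _ _ _).mpr
      ⟨k * z, hkz, by simp only [smul_eq_mul]; field_simp⟩⟩
  obtain ⟨w, hw⟩ := finrank_le_one_iff.mp (h _ hα)
  obtain ⟨c, hc⟩ := hw ⟨x, hx'⟩
  obtain ⟨d, hd⟩ := hw ⟨k * x, hkx'⟩
  replace hc : (c : K) * w = x := congrArg Subtype.val hc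
  replace hd : (d : K) * w = k * x := congrArg Subtype.val hd
  have hc₀ : (c : K) ≠ 0 := by
    intro hc₁
    exact hx₀ (by rw [← hc, hc₁, zero_mul])
  have hw₀ : (w : K) ≠ 0 := by
    intro hw₁
    exact hx₀ (by rw [← hc, hw₁, mul_zero])
  have hk : k = d / c := by
    rw [eq_div_iff hc₀]
    exact mul_right_cancel₀ hw₀ (by linear_combination k * hc - hd)
  rw [hk]
  exact F.div_mem d.2 c.2

theorem span_singleton_mul_eq_of_mem {K : Type*} [Field K] {F : Subfield K} {k : K}
    (hk : k ∈ F) (hk₀ : k ≠ 0) (a : K) :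
    Submodule.span F {k * a} = Submodule.span F {a} :=
  Submodule.span_singleton_smul_eq (r := (⟨k, hk⟩ : F))
    (isUnit_iff_ne_zero.mpr fun h => hk₀ (congrArg Subtype.val h)) a

/-- Two factorizations in `U + V` whose `U²`-, `UV`- and `V²`-components agree, and whose first
factors are proportional componentwise, agree up to scalars. -/
theorem span_pair_eq_of_proportional {K : Type*} [Field K] [Finite K] {F : Subfield K}
    {U V : Submodule F K} (hU : IsSidonSpace F U) (hV : IsSidonSpace F V)
    (h2 : ∀ α : K, α ≠ 0 → Module.finrank F ↥(U ⊓ α • V) ≤ 1)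
    {u₁ v₁ u₂ v₂ u₃ v₃ u₄ v₄ : K}
    (hu₁ : u₁ ∈ U) (hv₁ : v₁ ∈ V) (hu₂ : u₂ ∈ U) (hv₂ : v₂ ∈ V)
    (hu₃ : u₃ ∈ U) (hv₃ : v₃ ∈ V) (hu₄ : u₄ ∈ U) (hv₄ : v₄ ∈ V)
    (h₁ : u₁ + v₁ ≠ 0) (h₂ : u₂ + v₂ ≠ 0) (h₃ : u₃ + v₃ ≠ 0) (h₄ : u₄ + v₄ ≠ 0)
    (hu : u₁ * u₂ = u₃ * u₄) (hv : v₁ * v₂ = v₃ * v₄)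
    (huv : u₁ * v₂ + u₂ * v₁ = u₃ * v₄ + u₄ * v₃) (h : u₁ * v₃ = u₃ * v₁) :
    ({Submodule.span F {u₁ + v₁}, Submodule.span F {u₂ + v₂}} : Set (Submodule F K)) =
      {Submodule.span F {u₃ + v₃}, Submodule.span F {u₄ + v₄}} := by
  obtain ⟨k, hk₀, rfl, rfl, rfl, rfl⟩ := exists_ratio_of_mul_eq_mul hu hv huv h h₁ h₃
  have of_mem (hk : k ∈ F) :
      ({Submodule.span F {u₁ + v₁}, Submodule.span F {k * u₄ + k * v₄}} : Set (Submodule F K)) =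
        {Submodule.span F {k * u₁ + k * v₁}, Submodule.span F {u₄ + v₄}} := by
    rw [← mul_add, ← mul_add, span_singleton_mul_eq_of_mem hk hk₀,
      span_singleton_mul_eq_of_mem hk hk₀]
  by_cases hu₁₀ : u₁ = 0 <;> by_cases hv₁₀ : v₁ = 0
  · exact absurd (by rw [hu₁₀, hv₁₀, add_zero]) h₁
  · by_cases hu₄₀ : u₄ = 0
    · subst hu₁₀ hu₄₀
      simp only [mul_zero, zero_add] at h₁ h₂ h₃ h₄ ⊢
      exact hV _ hv₁ _ hv₂ _ hv₃ _ hv₄ h₁ h₂ h₃ h₄ hv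
    · exact of_mem (ratio_mem_of_finrank_inf_smul_le_one h2 hu₄ hu₂ hv₁ hv₃ hu₄₀ hv₁₀)
  · by_cases hv₄₀ : v₄ = 0
    · subst hv₁₀ hv₄₀
      simp only [mul_zero, add_zero] at h₁ h₂ h₃ h₄ ⊢
      exact hU _ hu₁ _ hu₂ _ hu₃ _ hu₄ h₁ h₂ h₃ h₄ hu
    · exact of_mem (ratio_mem_of_finrank_inf_smul_le_one h2 hu₁ hu₃ hv₄ hv₂ hu₁₀ hv₄₀)
  · exact of_mem (ratio_mem_of_finrank_inf_smul_le_one h2 hu₁ hu₃ hv₁ hv₃ hu₁₀ hv₁₀)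

/-- If `U`, `V` are Sidon spaces in `F_{q^n}` such that
`(U+V)² = U² ⊕ UV ⊕ V²` (an internal direct sum) and `dim (U ⊓ αV) ≤ 1` for every
nonzero `α`, then `U + V` is a Sidon space. -/
theorem sum_of_two_sidonSpaces {K : Type*} [Field K] (q n : ℕ)
    (hq : IsPrimePow q) (hn : 0 < n) (hK : Nat.card K = q ^ n)
    (F : Subfield K) (hF : Nat.card F = q)
    (U V : Submodule F K)
    (hU : IsSidonSpace F U) (hV : IsSidonSpace F V)
    (h1 : (U + V) * (U + V) = U * U + U * V + V * V)
    (h1a : (U * U) ⊓ (U * V + V * V) = ⊥)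
    (h1b : (U * V) ⊓ (U * U + V * V) = ⊥)
    (h1c : (V * V) ⊓ (U * U + U * V) = ⊥)
    (h2 : ∀ α : K, α ≠ 0 → Module.finrank F ↥(U ⊓ α • V) ≤ 1) :
    IsSidonSpace F (U + V) := by
  have : Finite K := Nat.finite_of_card_ne_zero (hK ▸ pow_ne_zero n hq.ne_zero)
  intro a ha b hb c hc d hd ha₀ hb₀ hc₀ hd₀ habcd
  rw [Submodule.add_eq_sup] at ha hb hc hd
  obtain ⟨u₁, hu₁, v₁, hv₁, rfl⟩ := Submodule.mem_sup.mp ha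
  obtain ⟨u₂, hu₂, v₂, hv₂, rfl⟩ := Submodule.mem_sup.mp hb
  obtain ⟨u₃, hu₃, v₃, hv₃, rfl⟩ := Submodule.mem_sup.mp hc
  obtain ⟨u₄, hu₄, v₄, hv₄, rfl⟩ := Submodule.mem_sup.mp hd
  have hUU : u₁ * u₂ - u₃ * u₄ ∈ U * U :=
    sub_mem (Submodule.mul_mem_mul hu₁ hu₂) (Submodule.mul_mem_mul hu₃ hu₄)
  have hVV : v₁ * v₂ - v₃ * v₄ ∈ V * V :=
    sub_mem (Submodule.mul_mem_mul hv₁ hv₂) (Submodule.mul_mem_mul hv₃ hv₄)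
  have hUV : u₁ * v₂ + u₂ * v₁ - (u₃ * v₄ + u₄ * v₃) ∈ U * V :=
    sub_mem (add_mem (Submodule.mul_mem_mul hu₁ hv₂) (Submodule.mul_mem_mul hu₂ hv₁))
      (add_mem (Submodule.mul_mem_mul hu₃ hv₄) (Submodule.mul_mem_mul hu₄ hv₃))
  have hu : u₁ * u₂ = u₃ * u₄ := by
    rw [← sub_eq_zero, ← Submodule.mem_bot F, ← h1a, Submodule.add_eq_sup]
    refine ⟨hUU, Submodule.mem_sup.mpr ⟨_, neg_mem hUV, _, neg_mem hVV, ?_⟩⟩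
    linear_combination -habcd
  have hv : v₁ * v₂ = v₃ * v₄ := by
    rw [← sub_eq_zero, ← Submodule.mem_bot F, ← h1c, Submodule.add_eq_sup]
    refine ⟨hVV, Submodule.mem_sup.mpr ⟨_, neg_mem hUU, _, neg_mem hUV, ?_⟩⟩
    linear_combination -habcd
  have huv : u₁ * v₂ + u₂ * v₁ = u₃ * v₄ + u₄ * v₃ := by
    linear_combination habcd - hu - hv
  rcases proportional_of_mul_eq_mul hu hv huv with h | h
  · exact span_pair_eq_of_proportional hU hV h2 hu₁ hv₁ hu₂ hv₂ hu₃ hv₃ hu₄ hv₄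
      ha₀ hb₀ hc₀ hd₀ hu hv huv h
  · rw [Set.pair_comm (Submodule.span F {u₃ + v₃})]
    exact span_pair_eq_of_proportional hU hV h2 hu₁ hv₁ hu₂ hv₂ hu₄ hv₄ hu₃ hv₃
      ha₀ hb₀ hd₀ hc₀ (hu.trans (mul_comm _ _)) (hv.trans (mul_comm _ _))
      (huv.trans (add_comm _ _)) h
end

section
/- Let q be a prime power, n a positive integer, m ≥ 2 an integer, and let V_1, …, V_m be Sidon spaces in F_{q^n}. Suppose that (1) the subspace (V_1 + ⋯ + V_m)^2 decomposes as the internal direct sum ⊕_{1 ≤ i ≤ j ≤ m} V_i V_j, and (2) dim_{F_q}(V_i ∩ αV_j) ≤ 1 for all 1 ≤ i ≠ j ≤ m and every α ∈ F_{q^n}^*. Then V_1 + ⋯ + V_m is also a Sidon space. -/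
open Submodule Pointwise

set_option maxHeartbeats 1000000
set_option synthInstance.maxHeartbeats 400000

section LinearForms

open MvPolynomial

variable {ι K : Type*} [Finite ι] [Field K]

/-- The linear form `∑ i, a i * X i`. -/
noncomputable def linearForm (a : ι → K) : MvPolynomial ι K :=
  sumSMulX (Finsupp.equivFunOnFinite.symm a)

theorem linearForm_eq_sum [Fintype ι] (a : ι → K) : linearForm a = ∑ i, C (a i) * X i := by
  simp [linearForm, sumSMulX, Finsupp.linearCombination_apply, Finsupp.sum_fintype, smul_eq_C_mul]

theorem linearForm_injective : Function.Injective (linearForm : (ι → K) → MvPolynomial ι K) := by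
  intro a b h
  funext i
  simpa [linearForm, coeff_sumSMulX] using congrArg (coeff (Finsupp.single i 1)) h

theorem linearForm_smul (l : K) (a : ι → K) : linearForm (l • a) = C l * linearForm a := by
  have := Fintype.ofFinite ι
  simp [linearForm_eq_sum, Finset.mul_sum, mul_assoc]

theorem linearForm_ne_zero {a : ι → K} (ha : a ≠ 0) : linearForm a ≠ 0 := by
  have h0 : linearForm (0 : ι → K) = 0 := by
    have := Fintype.ofFinite ι
    simp [linearForm_eq_sum]
  exact fun h => ha (linearForm_injective (h.trans h0.symm))

theorem irreducible_linearForm {a : ι → K} (ha : a ≠ 0) : Irreducible (linearForm a) := by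
  obtain ⟨i, hi⟩ := Function.ne_iff.mp ha
  refine irreducible_sumSMulX _ ⟨i, by simpa using hi⟩ fun r hr => ?_
  exact isUnit_of_dvd_unit (hr i) (IsUnit.mk0 _ (by simpa using hi))

/-- If a nonzero linear form divides another one, they are proportional. -/
theorem exists_smul_eq_of_linearForm_dvd {a c : ι → K} (ha : a ≠ 0) (hc : c ≠ 0)
    (h : linearForm a ∣ linearForm c) : ∃ l : K, l ≠ 0 ∧ c = l • a := by
  obtain ⟨u, hu⟩ := (irreducible_linearForm ha).associated_of_dvd (irreducible_linearForm hc) h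
  obtain ⟨l, hl, hlu⟩ := isUnit_iff_eq_C_of_isReduced.mp u.isUnit
  refine ⟨l, hl.ne_zero, linearForm_injective ?_⟩
  rw [linearForm_smul, ← hu, hlu, mul_comm]

/-- Two factorizations of a quadratic form into nonzero linear forms agree up to scalars. -/
theorem exists_smul_eq_of_linearForm_mul_eq {a b c d : ι → K} (ha : a ≠ 0) (hc : c ≠ 0)
    (hd : d ≠ 0) (h : linearForm a * linearForm b = linearForm c * linearForm d) :
    ∃ l : K, l ≠ 0 ∧ ((c = l • a ∧ b = l • d) ∨ (d = l • a ∧ b = l • c)) := by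
  have cancel : ∀ {c d : ι → K} {l : K}, linearForm a * linearForm b =
      linearForm c * linearForm d → c = l • a → b = l • d := by
    intro c d l h hl
    apply linearForm_injective
    apply mul_left_cancel₀ (linearForm_ne_zero ha)
    rw [h, hl, linearForm_smul, linearForm_smul]
    ring
  rcases (irreducible_linearForm ha).prime.dvd_or_dvd (h ▸ Dvd.intro _ rfl) with h' | h'
  · obtain ⟨l, hl, hla⟩ := exists_smul_eq_of_linearForm_dvd ha hc h'
    exact ⟨l, hl, .inl ⟨hla, cancel h hla⟩⟩
  · obtain ⟨l, hl, hla⟩ := exists_smul_eq_of_linearForm_dvd ha hd h'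
    exact ⟨l, hl, .inr ⟨hla, cancel (h.trans (mul_comm _ _)) hla⟩⟩

end LinearForms

/-- A double sum, with the terms at `(i, j)` and `(j, i)` grouped together. -/
theorem sum_sum_eq_sum_filter_le {ι M : Type*} [Fintype ι] [LinearOrder ι] [AddCommMonoid M]
    (f : ι → ι → M) :
    ∑ i, ∑ j, f i j = ∑ p ∈ Finset.univ.filter (fun p : ι × ι => p.1 ≤ p.2),
      (f p.1 p.2 + if p.1 = p.2 then 0 else f p.2 p.1) := by
  have h : ∑ p ∈ Finset.univ.filter (fun p : ι × ι => p.1 ≤ p.2),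
      (if p.1 = p.2 then 0 else f p.2 p.1) =
      ∑ p ∈ Finset.univ.filter (fun p : ι × ι => ¬ p.1 ≤ p.2), f p.1 p.2 := by
    simp only [Finset.sum_filter, Fintype.sum_prod_type]
    rw [Finset.sum_comm]
    refine Finset.sum_congr rfl fun i _ => Finset.sum_congr rfl fun j _ => ?_
    rcases lt_trichotomy i j with h | h | h
    · simp [h.le, h.not_ge]
    · simp [h]
    · simp [h.le, h.not_ge, h.ne]
  rw [Finset.sum_add_distrib, h, Finset.sum_filter_add_sum_filter_not, Fintype.sum_prod_type]

section Submodules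

variable {K : Type*} [Field K] {F : Subfield K}

theorem Submodule.finsetSum_mem_sum {κ : Type*} (s : Finset κ) (W : κ → Submodule F K) (x : κ → K)
    (hx : ∀ p ∈ s, x p ∈ W p) : ∑ p ∈ s, x p ∈ ∑ p ∈ s, W p := by
  classical
  induction s using Finset.induction_on with
  | empty => simp
  | insert p s hp ih =>
    rw [Finset.sum_insert hp, Finset.sum_insert hp]
    exact Submodule.add_mem_sup (hx p (by simp)) (ih fun r hr => hx r (by simp [hr]))

theorem Submodule.exists_eq_finsetSum {κ : Type*} (s : Finset κ) (W : κ → Submodule F K) {y : K}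
    (hy : y ∈ ∑ p ∈ s, W p) : ∃ x : κ → K, (∀ p, x p ∈ W p) ∧ y = ∑ p ∈ s, x p := by
  classical
  induction s using Finset.induction_on generalizing y with
  | empty => exact ⟨0, fun p => (W p).zero_mem, by simpa using hy⟩
  | insert p s hp ih =>
    rw [Finset.sum_insert hp] at hy
    obtain ⟨u, hu, v, hv, rfl⟩ := Submodule.mem_sup.mp hy
    obtain ⟨x, hx, rfl⟩ := ih hv
    refine ⟨Function.update x p u, fun r => ?_, ?_⟩
    · by_cases hr : r = p
      · subst hr; simpa using hu
      · simpa [hr] using hx r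
    · rw [Finset.sum_insert hp, Function.update_self]
      congr 1
      exact Finset.sum_congr rfl fun r hr => by
        rw [Function.update_of_ne (ne_of_mem_of_not_mem hr hp)]

/-- If subspaces `V`, `W` contain nonzero `x, l * x` and `y, l * y` respectively,
and `V` meets every multiple of `W` in dimension at most one, then `l` is a scalar of `F`. -/
theorem mem_subfield_of_finrank_inf_smul_le_one [Finite K] {V W : Submodule F K}
    (h : ∀ α : K, α ≠ 0 → Module.finrank F ↥(V ⊓ α • W) ≤ 1) {l x y : K}
    (hx0 : x ≠ 0) (hy0 : y ≠ 0) (hx : x ∈ V) (hlx : l * x ∈ V) (hy : y ∈ W) (hly : l * y ∈ W) :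
    l ∈ F := by
  have hα : x / y ≠ 0 := div_ne_zero hx0 hy0
  have h1 : x ∈ V ⊓ (x / y) • W :=
    ⟨hx, Submodule.mem_smul_pointwise_iff_exists _ _ _ |>.mpr ⟨y, hy, by simp [hy0]⟩⟩
  have h2 : l * x ∈ V ⊓ (x / y) • W :=
    ⟨hlx, Submodule.mem_smul_pointwise_iff_exists _ _ _ |>.mpr
      ⟨l * y, hly, by simp only [smul_eq_mul]; field_simp⟩⟩
  obtain ⟨v, hv⟩ := finrank_le_one_iff.mp (h _ hα)
  obtain ⟨r, hr⟩ := hv ⟨x, h1⟩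
  obtain ⟨s, hs⟩ := hv ⟨l * x, h2⟩
  have hr' : (r : K) * (v : K) = x := congrArg Subtype.val hr
  have hs' : (s : K) * (v : K) = l * x := congrArg Subtype.val hs
  have hv0 : (v : K) ≠ 0 := by rintro h0; simp [h0] at hr'; exact hx0 hr'.symm
  have hr0 : (r : K) ≠ 0 := by rintro h0; simp [h0] at hr'; exact hx0 hr'.symm
  have hl : l = (s : K) / r := by
    rw [eq_div_iff hr0]
    apply mul_right_cancel₀ hv0
    rw [hs', mul_assoc, hr']
  exact hl ▸ F.div_mem s.2 r.2

theorem span_singleton_mul_eq {l : K} (hl : l ≠ 0) (hlF : l ∈ F) (x : K) :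
    Submodule.span F {l * x} = Submodule.span F {x} :=
  Submodule.span_singleton_smul_eq (r := (⟨l, hlF⟩ : F))
    (IsUnit.mk0 _ fun h => hl (congrArg Subtype.val h)) x

/-- Two nonzero families stay in the `V i` after multiplication by `l`: then `l` is a
scalar, or both families are supported at one common index. -/
theorem mem_subfield_or_exists_support [Finite K] {ι : Type*} {V : ι → Submodule F K}
    (h : ∀ i j, i ≠ j → ∀ α : K, α ≠ 0 → Module.finrank F ↥(V i ⊓ α • V j) ≤ 1)
    {x y : ι → K} {l : K} (hx0 : x ≠ 0) (hx : ∀ i, x i ∈ V i) (hlx : ∀ i, l * x i ∈ V i)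
    (hy : ∀ i, y i ∈ V i) (hly : ∀ i, l * y i ∈ V i) :
    l ∈ F ∨ ∃ i, ∀ j, j ≠ i → x j = 0 ∧ y j = 0 := by
  obtain ⟨i, hi⟩ := Function.ne_iff.mp hx0
  refine or_iff_not_imp_left.mpr fun hl => ⟨i, fun j hj => ⟨?_, ?_⟩⟩
  · by_contra hxj
    exact hl (mem_subfield_of_finrank_inf_smul_le_one (h i j hj.symm) hi hxj
      (hx i) (hlx i) (hx j) (hlx j))
  · by_contra hyj
    exact hl (mem_subfield_of_finrank_inf_smul_le_one (h i j hj.symm) hi hyj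
      (hx i) (hlx i) (hy j) (hly j))

/-- An equality of products in `(∑ i, V i) ^ 2` lifts to an equality of quadratic forms when
that square is the direct sum of the `V i * V j`, `i ≤ j`. -/
theorem linearForm_mul_eq_of_sum_mul_sum_eq {ι : Type*} [Fintype ι] [LinearOrder ι]
    {V : ι → Submodule F K}
    (h : ∀ p : ι × ι, p.1 ≤ p.2 →
      (V p.1 * V p.2) ⊓
        (∑ p' ∈ Finset.univ.filter (fun p' : ι × ι => p'.1 ≤ p'.2 ∧ p' ≠ p),
          V p'.1 * V p'.2) = ⊥)
    {a b c d : ι → K} (ha : ∀ i, a i ∈ V i) (hb : ∀ i, b i ∈ V i) (hc : ∀ i, c i ∈ V i)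
    (hd : ∀ i, d i ∈ V i) (heq : (∑ i, a i) * ∑ i, b i = (∑ i, c i) * ∑ i, d i) :
    linearForm a * linearForm b = linearForm c * linearForm d := by
  let f : ι → ι → K := fun i j => a i * b j - c i * d j
  let e : ι × ι → K := fun p => f p.1 p.2 + if p.1 = p.2 then 0 else f p.2 p.1
  have hf : ∀ i j, f i j ∈ V i * V j := fun i j =>
    sub_mem (Submodule.mul_mem_mul (ha i) (hb j)) (Submodule.mul_mem_mul (hc i) (hd j))
  have he : ∀ p, e p ∈ V p.1 * V p.2 := by
    intro p
    refine add_mem (hf _ _) ?_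
    split_ifs
    · exact zero_mem _
    · rw [mul_comm]
      exact hf _ _
  have hsum : ∑ p ∈ Finset.univ.filter (fun p : ι × ι => p.1 ≤ p.2), e p = 0 := by
    rw [← sum_sum_eq_sum_filter_le]
    simp only [f, Finset.sum_sub_distrib, ← Finset.sum_mul_sum, heq, sub_self]
  have he0 : ∀ p : ι × ι, p.1 ≤ p.2 → e p = 0 := by
    intro p hp
    have hfil : (Finset.univ.filter (fun p : ι × ι => p.1 ≤ p.2)).erase p =
        Finset.univ.filter (fun p' : ι × ι => p'.1 ≤ p'.2 ∧ p' ≠ p) := by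
      ext r; simp [and_comm]
    have hrest : e p = -∑ p' ∈ Finset.univ.filter
        (fun p' : ι × ι => p'.1 ≤ p'.2 ∧ p' ≠ p), e p' := by
      rw [← hfil, eq_neg_iff_add_eq_zero, Finset.add_sum_erase _ _ (by simpa using hp), hsum]
    have hmem : e p ∈ (V p.1 * V p.2) ⊓
        (∑ p' ∈ Finset.univ.filter (fun p' : ι × ι => p'.1 ≤ p'.2 ∧ p' ≠ p),
          V p'.1 * V p'.2) := by
      refine ⟨he p, ?_⟩
      rw [hrest]
      exact neg_mem (Submodule.finsetSum_mem_sum _ (fun p' : ι × ι => V p'.1 * V p'.2) _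
        fun r _ => he r)
    rwa [h p hp, Submodule.mem_bot] at hmem
  have hforms : linearForm a * linearForm b - linearForm c * linearForm d =
      ∑ i, ∑ j, MvPolynomial.C (f i j) * (MvPolynomial.X i * MvPolynomial.X j) := by
    simp only [linearForm_eq_sum, Finset.sum_mul_sum, ← Finset.sum_sub_distrib, f, map_sub,
      map_mul]
    exact Finset.sum_congr rfl fun i _ => Finset.sum_congr rfl fun j _ => by ring
  rw [← sub_eq_zero, hforms, sum_sum_eq_sum_filter_le]
  refine Finset.sum_eq_zero fun p hp => ?_
  have h0 := he0 p (by simpa using hp)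
  simp only [e] at h0
  split_ifs at h0 ⊢ with hpq
  · rw [add_zero] at h0 ⊢
    rw [h0, map_zero, zero_mul]
  · rw [mul_comm (MvPolynomial.X p.2), ← add_mul, ← map_add, h0, map_zero, zero_mul]

end Submodules

/-- If `V₁, …, Vₘ` (`m ≥ 2`) are Sidon spaces in `F_{q^n}` such that
`(V₁ + ⋯ + Vₘ)² = ⊕_{i ≤ j} VᵢVⱼ` (an internal direct sum) and
`dim (Vᵢ ⊓ αVⱼ) ≤ 1` for all `i ≠ j` and nonzero `α`, then `V₁ + ⋯ + Vₘ` is a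
Sidon space. -/
theorem sum_of_sidonSpaces {K : Type*} [Field K] (q n m : ℕ)
    (hq : IsPrimePow q) (hn : 0 < n) (hm : 2 ≤ m) (hK : Nat.card K = q ^ n)
    (F : Subfield K) (hF : Nat.card F = q)
    (V : Fin m → Submodule F K)
    (hV : ∀ i, IsSidonSpace F (V i))
    (h1 : (∑ i, V i) * (∑ i, V i) =
      ∑ p ∈ Finset.univ.filter (fun p : Fin m × Fin m => p.1 ≤ p.2), V p.1 * V p.2)
    (h1d : ∀ p : Fin m × Fin m, p.1 ≤ p.2 →
      (V p.1 * V p.2) ⊓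
        (∑ p' ∈ Finset.univ.filter (fun p' : Fin m × Fin m => p'.1 ≤ p'.2 ∧ p' ≠ p),
          V p'.1 * V p'.2) = ⊥)
    (h2 : ∀ i j : Fin m, i ≠ j → ∀ α : K, α ≠ 0 →
      Module.finrank F ↥(V i ⊓ α • V j) ≤ 1) :
    IsSidonSpace F (∑ i, V i) := by
  have : Finite K := Nat.finite_of_card_ne_zero (hK ▸ pow_ne_zero n hq.ne_zero)
  intro a hxa b hxb c hxc d hxd ha0 hb0 hc0 hd0 habcd
  obtain ⟨a, ha, rfl⟩ := Submodule.exists_eq_finsetSum _ _ hxa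
  obtain ⟨b, hb, rfl⟩ := Submodule.exists_eq_finsetSum _ _ hxb
  obtain ⟨c, hc, rfl⟩ := Submodule.exists_eq_finsetSum _ _ hxc
  obtain ⟨d, hd, rfl⟩ := Submodule.exists_eq_finsetSum _ _ hxd
  have ne_zero : ∀ {x : Fin m → K}, ∑ i, x i ≠ 0 → x ≠ 0 := by
    rintro x hx rfl
    simp at hx
  have single : ∀ {x : Fin m → K} {i}, (∀ j, j ≠ i → x j = 0) → ∑ i, x i = x i :=
    fun h => Fintype.sum_eq_single _ h
  have key : ∀ {c d : Fin m → K} {l : K}, (∀ i, c i ∈ V i) → (∀ i, d i ∈ V i) →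
      ∑ i, c i ≠ 0 → ∑ i, d i ≠ 0 → (∑ i, a i) * ∑ i, b i = (∑ i, c i) * ∑ i, d i →
      l ≠ 0 → c = l • a → b = l • d →
      ({Submodule.span F {∑ i, a i}, Submodule.span F {∑ i, b i}} : Set (Submodule F K)) =
        {Submodule.span F {∑ i, c i}, Submodule.span F {∑ i, d i}} := by
    intro c d l hc hd hc0 hd0 habcd hl hca hbd
    have hca' : ∀ i, c i = l * a i := fun i => congrFun hca i
    have hbd' : ∀ i, b i = l * d i := fun i => congrFun hbd i
    rcases mem_subfield_or_exists_support h2 (ne_zero ha0) ha (fun i => hca' i ▸ hc i) hd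
      (fun i => hbd' i ▸ hb i) with hlF | ⟨i, hi⟩
    · simp only [hca', hbd', ← Finset.mul_sum, span_singleton_mul_eq hl hlF]
    · rw [single fun j hj => (hi j hj).1] at ha0 habcd ⊢
      rw [single fun j hj => (hi j hj).2] at hd0 habcd ⊢
      rw [single fun j hj => show c j = 0 by rw [hca', (hi j hj).1, mul_zero]] at hc0 habcd ⊢
      rw [single fun j hj => show b j = 0 by rw [hbd', (hi j hj).2, mul_zero]] at hb0 habcd ⊢
      exact hV i _ (ha i) _ (hb i) _ (hc i) _ (hd i) ha0 hb0 hc0 hd0 habcd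
  obtain ⟨l, hl, ⟨hca, hbd⟩ | ⟨hda, hbc⟩⟩ := exists_smul_eq_of_linearForm_mul_eq (ne_zero ha0)
    (ne_zero hc0) (ne_zero hd0) (linearForm_mul_eq_of_sum_mul_sum_eq h1d ha hb hc hd habcd)
  · exact key hc hd hc0 hd0 habcd hl hca hbd
  · rw [key hd hc hd0 hc0 (habcd.trans (mul_comm _ _)) hl hda hbc, Set.pair_comm]
end

section
/- Let q be a prime power and n, k positive integers with k | n. Let γ ∈ F_{q^n}^* be a root of an irreducible polynomial of degree n/k over F_{q^k}, where n/k > 2, and let δ, τ ∈ F_{q^k}^*. Then U = {δu + τu^q γ : u ∈ F_{q^k}} is a Sidon space of F_q-dimension k. -/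
open Submodule Pointwise

set_option maxHeartbeats 1000000
set_option synthInstance.maxHeartbeats 400000

theorem Subfield.mem_of_pow_natCard_eq_self {K : Type*} [Field K] (F : Subfield K) [Finite F]
    {x : K} (hx : x ^ Nat.card F = x) : x ∈ F := by
  classical
  have : Fintype F := Fintype.ofFinite F
  have hc : 1 < Nat.card F := Finite.one_lt_card
  have hp : (Polynomial.X ^ Nat.card F - Polynomial.X : Polynomial K) ≠ 0 :=
    FiniteField.X_pow_card_sub_X_ne_zero K hc
  have hdeg : (Polynomial.X ^ Nat.card F - Polynomial.X : Polynomial K).natDegree = Nat.card F :=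
    FiniteField.X_pow_card_sub_X_natDegree_eq K hc
  have hsub : (F : Set K).toFinset ⊆
      (Polynomial.X ^ Nat.card F - Polynomial.X : Polynomial K).roots.toFinset := by
    intro y hy
    have hyF : y ∈ F := by simpa using hy
    have hpow : (⟨y, hyF⟩ : F) ^ Nat.card F = ⟨y, hyF⟩ := by
      rw [Nat.card_eq_fintype_card]; exact FiniteField.pow_card _
    have hpow' : y ^ Nat.card F = y := congrArg Subtype.val hpow
    rw [Multiset.mem_toFinset, Polynomial.mem_roots hp]
    simp [hpow', -Nat.card_eq_fintype_card]
  have heq := Finset.eq_of_subset_of_card_le hsub (by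
    calc _ ≤ _ := Multiset.toFinset_card_le _
      _ ≤ _ := Polynomial.card_roots' _
      _ = Nat.card F := hdeg
      _ ≤ _ := by rw [Set.toFinset_card, Nat.card_eq_fintype_card]; exact le_of_eq rfl)
  have hmem : x ∈ (F : Set K).toFinset := by
    rw [heq, Multiset.mem_toFinset, Polynomial.mem_roots hp]
    simp [hx, -Nat.card_eq_fintype_card]
  simpa using hmem

theorem Subfield.coeffs_eq_zero_of_two_lt_natDegree_minpoly {K : Type*} [Field K] (E : Subfield K)
    {γ : K} (h : 2 < (minpoly E γ).natDegree) {a b c : K} (ha : a ∈ E) (hb : b ∈ E) (hc : c ∈ E)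
    (h0 : a + b * γ + c * γ ^ 2 = 0) : a = 0 ∧ b = 0 ∧ c = 0 := by
  set p : Polynomial E := Polynomial.C ⟨c, hc⟩ * Polynomial.X ^ 2 +
    Polynomial.C ⟨b, hb⟩ * Polynomial.X + Polynomial.C ⟨a, ha⟩ with hp
  have hroot : Polynomial.aeval γ p = 0 := by
    simp only [hp, map_add, map_mul, map_pow, Polynomial.aeval_C, Polynomial.aeval_X]
    change c * γ ^ 2 + b * γ + a = 0
    linear_combination h0
  have hp0 : p = 0 := by
    by_contra hne
    have h1 := Polynomial.natDegree_le_natDegree (minpoly.degree_le_of_ne_zero E γ hne hroot)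
    have h2 : p.natDegree ≤ 2 := Polynomial.natDegree_quadratic_le
    omega
  have h2 : p.coeff 2 = 0 := by rw [hp0]; simp
  have h1 : p.coeff 1 = 0 := by rw [hp0]; simp
  have h3 : p.coeff 0 = 0 := by rw [hp0]; simp
  simp [hp, Polynomial.coeff_X, Polynomial.coeff_C] at h1 h2 h3
  exact ⟨congrArg Subtype.val h3, congrArg Subtype.val h1, congrArg Subtype.val h2⟩

/-- The `F`-linear map `u ↦ δu + τuᑫγ`, where `q = |F|`. -/
noncomputable def deltaTauMap {K : Type*} [Field K] (F : Subfield K) [Fintype F] (δ τ γ : K) :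
    K →ₗ[F] K :=
  LinearMap.mulLeft F δ +
    LinearMap.mulLeft F (τ * γ) ∘ₗ (FiniteField.frobeniusAlgHom F K).toLinearMap

theorem deltaTauMap_apply {K : Type*} [Field K] (F : Subfield K) [Fintype F] (δ τ γ u : K) :
    deltaTauMap F δ τ γ u = δ * u + τ * u ^ Nat.card F * γ := by
  simp [deltaTauMap, FiniteField.frobeniusAlgHom_apply, Nat.card_eq_fintype_card]
  ring

theorem exists_smul_eq_of_mul_pow_eq {K : Type*} [Field K] (F : Subfield K) [Finite F] {x y : K}
    (hx : x ≠ 0) (hy : y ≠ 0) (h : x ^ Nat.card F * y = y ^ Nat.card F * x) :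
    ∃ r : Fˣ, x = r • y := by
  have hmem : x / y ∈ F := F.mem_of_pow_natCard_eq_self (by
    rw [div_pow, div_eq_div_iff (pow_ne_zero _ hy) hy, h, mul_comm])
  refine ⟨Units.mk0 ⟨x / y, hmem⟩ fun h0 ↦ div_ne_zero hx hy (congrArg Subtype.val h0), ?_⟩
  change x = x / y * y
  field_simp

theorem span_singleton_map_eq_of_mul_pow_eq {K : Type*} [Field K] (F : Subfield K) [Finite F]
    (L : K →ₗ[F] K) {x y : K} (hx : x ≠ 0) (hy : y ≠ 0)
    (h : x ^ Nat.card F * y = y ^ Nat.card F * x) :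
    Submodule.span F {L x} = Submodule.span F {L y} := by
  obtain ⟨r, hr⟩ := exists_smul_eq_of_mul_pow_eq F hx hy h
  rw [hr, Units.smul_def, map_smul, ← Units.smul_def]
  exact Submodule.span_singleton_group_smul_eq F r (L y)

/-- Two pairs with the same product and the same value of `uvᑫ + uᑫv` agree up to order
and scaling by elements fixed under `x ↦ xᑫ`. -/
theorem mul_pow_eq_or_of_mul_eq_of_add_eq {K : Type*} [Field K] {q : ℕ} {u v w z : K}
    (hu : u ≠ 0) (hv : v ≠ 0) (hprod : u * v = w * z)
    (hsum : u * v ^ q + u ^ q * v = w * z ^ q + w ^ q * z) :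
    (u ^ q * w = w ^ q * u ∧ v ^ q * z = z ^ q * v) ∨
      (u ^ q * z = z ^ q * u ∧ v ^ q * w = w ^ q * v) := by
  have hpow : u ^ q * v ^ q = w ^ q * z ^ q := by rw [← mul_pow, hprod, mul_pow]
  have hfac : (u * v ^ q - w * z ^ q) * (u * v ^ q - w ^ q * z) = 0 := by
    linear_combination (u * v ^ q) * hsum - (u ^ q * v ^ q) * hprod - (w * z) * hpow
  rcases mul_eq_zero.1 hfac with h | h
  · have h' : u ^ q * v = w ^ q * z := by linear_combination hsum - h
    refine .inl ⟨mul_left_cancel₀ hv ?_, mul_left_cancel₀ hu ?_⟩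
    · linear_combination w * h' - w ^ q * hprod
    · linear_combination z * h - z ^ q * hprod
  · have h' : u ^ q * v = w * z ^ q := by linear_combination hsum - h
    refine .inr ⟨mul_left_cancel₀ hv ?_, mul_left_cancel₀ hu ?_⟩
    · linear_combination z * h' - z ^ q * hprod
    · linear_combination w * h - w ^ q * hprod

/-- For `k ∣ n`, `γ` a root of an irreducible polynomial of degree
`n/k > 2` over `F_{q^k}`, and `δ, τ ∈ F_{q^k}^*`, the set
`U = {δu + τuᑫγ : u ∈ F_{q^k}}` is a Sidon space of dimension `k` over `F_q`. -/
theorem sidonSpace_delta_tau {K : Type*} [Field K] (q n k : ℕ)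
    (hq : IsPrimePow q) (hn : 0 < n) (hk : 0 < k) (hkn : k ∣ n)
    (hK : Nat.card K = q ^ n)
    (F : Subfield K) (hF : Nat.card F = q)
    (Fk : Subfield K) (hFk : Nat.card Fk = q ^ k) (hFFk : F ≤ Fk)
    (γ : K) (hγ : γ ≠ 0)
    (hdeg : (minpoly Fk γ).natDegree = n / k) (hdeg2 : 2 < n / k)
    (δ τ : K) (hδ : δ ∈ Fk) (hτ : τ ∈ Fk) (hδ0 : δ ≠ 0) (hτ0 : τ ≠ 0) :
    IsSidonSpace F
        (Submodule.span F {x : K | ∃ u ∈ Fk, x = δ * u + τ * u ^ q * γ}) ∧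
      Module.finrank F
        ↥(Submodule.span F {x : K | ∃ u ∈ Fk, x = δ * u + τ * u ^ q * γ}) = k := by
  subst hF
  have hq1 : 1 < Nat.card F := hq.one_lt
  have : Finite F := Nat.finite_of_card_ne_zero (by omega)
  have : Finite K := Nat.finite_of_card_ne_zero (by rw [hK]; positivity)
  have : Fintype F := Fintype.ofFinite F
  rw [← hdeg] at hdeg2
  set q := Nat.card F with hqdef
  set L := deltaTauMap F δ τ γ with hL
  have hLapp (u : K) : L u = δ * u + τ * u ^ q * γ := deltaTauMap_apply F δ τ γ u
  let E : Submodule F K :=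
    { Fk.toAddSubgroup with
      smul_mem' := fun c x hx ↦ Fk.mul_mem (hFFk c.2) hx }
  have hE (x : K) : x ∈ E ↔ x ∈ Fk := Iff.rfl
  have hset : {x : K | ∃ u ∈ Fk, x = δ * u + τ * u ^ q * γ} = E.map L := by
    ext x
    simp only [Set.mem_ofPred_eq, SetLike.mem_coe, Submodule.mem_map, hE, hLapp, eq_comm]
  rw [hset, Submodule.span_eq]
  constructor
  · rintro _ ⟨u, hu, rfl⟩ _ ⟨v, hv, rfl⟩ _ ⟨w, hw, rfl⟩ _ ⟨z, hz, rfl⟩ ha hb hc hd hprod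
    have hu' : u ∈ Fk := hu
    have hv' : v ∈ Fk := hv
    have hw' : w ∈ Fk := hw
    have hz' : z ∈ Fk := hz
    have hu0 : u ≠ 0 := by rintro rfl; simp at ha
    have hv0 : v ≠ 0 := by rintro rfl; simp at hb
    have hw0 : w ≠ 0 := by rintro rfl; simp at hc
    have hz0 : z ≠ 0 := by rintro rfl; simp at hd
    rw [hLapp, hLapp, hLapp, hLapp] at hprod
    obtain ⟨h1, h2, -⟩ := Fk.coeffs_eq_zero_of_two_lt_natDegree_minpoly hdeg2
      (a := δ ^ 2 * (u * v - w * z))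
      (b := δ * τ * (u * v ^ q + u ^ q * v - (w * z ^ q + w ^ q * z)))
      (c := τ ^ 2 * (u ^ q * v ^ q - w ^ q * z ^ q))
      (mul_mem (pow_mem hδ 2) (sub_mem (mul_mem hu' hv') (mul_mem hw' hz')))
      (mul_mem (mul_mem hδ hτ) (sub_mem
        (add_mem (mul_mem hu' (pow_mem hv' q)) (mul_mem (pow_mem hu' q) hv'))
        (add_mem (mul_mem hw' (pow_mem hz' q)) (mul_mem (pow_mem hw' q) hz'))))
      (mul_mem (pow_mem hτ 2) (sub_mem (mul_mem (pow_mem hu' q) (pow_mem hv' q))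
        (mul_mem (pow_mem hw' q) (pow_mem hz' q))))
      (by linear_combination hprod)
    have huv : u * v = w * z := by
      simpa [hδ0, sub_eq_zero] using h1
    have hsum : u * v ^ q + u ^ q * v = w * z ^ q + w ^ q * z := by
      simpa [hδ0, hτ0, sub_eq_zero] using h2
    rcases mul_pow_eq_or_of_mul_eq_of_add_eq hu0 hv0 huv hsum with ⟨h, h'⟩ | ⟨h, h'⟩
    · rw [span_singleton_map_eq_of_mul_pow_eq F L hu0 hw0 h,
        span_singleton_map_eq_of_mul_pow_eq F L hv0 hz0 h']
    · rw [span_singleton_map_eq_of_mul_pow_eq F L hu0 hz0 h,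
        span_singleton_map_eq_of_mul_pow_eq F L hv0 hw0 h', Set.pair_comm]
  · have hinj : Function.Injective (L.domRestrict E) := by
      rw [← LinearMap.ker_eq_bot, LinearMap.ker_eq_bot']
      rintro ⟨u, hu⟩ h0
      have hu' : u ∈ Fk := hu
      have h0' : L u = 0 := h0
      rw [hLapp] at h0'
      obtain ⟨h1, -⟩ := Fk.coeffs_eq_zero_of_two_lt_natDegree_minpoly hdeg2
        (mul_mem hδ hu') (mul_mem hτ (pow_mem hu' q)) (zero_mem Fk)
        (by linear_combination h0')
      ext
      simpa [hδ0] using h1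
    have hrange : LinearMap.range (L.domRestrict E) = E.map L := by
      rw [LinearMap.range_domRestrict]
    rw [← hrange, LinearMap.finrank_range_of_inj hinj]
    have hcard : Nat.card E = Nat.card F ^ Module.finrank F E := Module.natCard_eq_pow_finrank
    have hcard' : Nat.card E = q ^ k := hFk
    exact Nat.pow_right_injective hq1 (hcard.symm.trans hcard')
end

section
/- Let q be a prime power and n, k, t, s positive integers with k | n and gcd(t − s, k) = 1. Let γ ∈ F_{q^n}^* be a root of an irreducible polynomial of degree n/k over F_{q^k}, where n/k > 2. Then U = {u^{q^t} + u^{q^s} γ : u ∈ F_{q^k}} is a Sidon space of F_q-dimension k. -/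
open Submodule Pointwise

set_option maxHeartbeats 1000000
set_option synthInstance.maxHeartbeats 400000

/-- Elements with `r ^ q ^ t = r ^ q ^ s` and `r ^ q ^ k = r` are fixed by `x ↦ x ^ q` when
`t - s` and `k` are coprime, provided `x ↦ x ^ q` is injective. -/
theorem pow_eq_self_of_pow_pow_eq {K : Type*} [Monoid K] {q k t s : ℕ}
    (hinj : Function.Injective fun x : K => x ^ q)
    (hts : Int.gcd ((t : ℤ) - (s : ℤ)) (k : ℤ) = 1) {r : K}
    (hk : r ^ q ^ k = r) (h : r ^ q ^ t = r ^ q ^ s) : r ^ q = r := by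
  have hiter (m : ℕ) (x : K) : (fun x : K => x ^ q)^[m] x = x ^ q ^ m := by
    rw [pow_iterate]
  wlog hle : s ≤ t generalizing s t
  · exact this (by rwa [← Int.neg_sub, Int.neg_gcd]) h.symm (le_of_not_ge hle)
  obtain ⟨m, rfl⟩ := Nat.exists_eq_add_of_le hle
  have hm : Function.IsPeriodicPt (fun x : K => x ^ q) m r := by
    refine hinj.iterate s ?_
    rw [← Function.iterate_add_apply, hiter, hiter, h]
  have hk' : Function.IsPeriodicPt (fun x : K => x ^ q) k r := (hiter k r).trans hk
  have hgcd : m.gcd k = 1 := by simpa using hts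
  have := hm.gcd hk'
  rw [hgcd] at this
  exact this

/-- A finite subfield of order `q` contains every solution of `r ^ q = r`. -/
theorem Subfield.mem_of_pow_card_eq {K : Type*} [Field K] (F : Subfield K) [Finite F] {r : K}
    (hr : r ^ Nat.card F = r) : r ∈ F := by
  classical
  have := Fintype.ofFinite F
  have hcard : 1 < Nat.card F := Finite.one_lt_card
  have hne : (Polynomial.X ^ Nat.card F - Polynomial.X : Polynomial K) ≠ 0 :=
    FiniteField.X_pow_card_sub_X_ne_zero K hcard
  have hsub : Finset.univ.image (fun x : F => (x : K)) ⊆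
      (Polynomial.X ^ Nat.card F - Polynomial.X : Polynomial K).roots.toFinset := by
    intro x hx
    obtain ⟨y, -, rfl⟩ := Finset.mem_image.1 hx
    have hy : (y : K) ^ Nat.card F = y := by
      rw [Nat.card_eq_fintype_card]
      exact congrArg Subtype.val (FiniteField.pow_card y)
    rw [Multiset.mem_toFinset, Polynomial.mem_roots hne, Polynomial.IsRoot.def, Polynomial.eval_sub,
      Polynomial.eval_pow, Polynomial.eval_X, hy, sub_self]
  have heq := Finset.eq_of_subset_of_card_le hsub (by
    rw [Finset.card_image_of_injective _ Subtype.val_injective, Finset.card_univ,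
      ← Nat.card_eq_fintype_card]
    refine (Multiset.toFinset_card_le _).trans ((Polynomial.card_roots' _).trans ?_)
    rw [FiniteField.X_pow_card_sub_X_natDegree_eq K hcard])
  have hmem : r ∈ (Polynomial.X ^ Nat.card F - Polynomial.X : Polynomial K).roots.toFinset := by
    rw [Multiset.mem_toFinset, Polynomial.mem_roots hne, Polynomial.IsRoot.def, Polynomial.eval_sub,
      Polynomial.eval_pow, Polynomial.eval_X, hr, sub_self]
  rw [← heq] at hmem
  obtain ⟨y, -, rfl⟩ := Finset.mem_image.1 hmem
  exact y.2

theorem Subfield.quadratic_eq_zero {K : Type*} [Field K] {E : Subfield K} {γ : K}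
    (hdeg : 2 < (minpoly E γ).natDegree) {a b c : K} (ha : a ∈ E) (hb : b ∈ E) (hc : c ∈ E)
    (h : a * γ ^ 2 + b * γ + c = 0) : a = 0 ∧ b = 0 ∧ c = 0 := by
  let p : Polynomial E := Polynomial.C ⟨a, ha⟩ * Polynomial.X ^ 2 +
    Polynomial.C ⟨b, hb⟩ * Polynomial.X + Polynomial.C ⟨c, hc⟩
  have hp : p = 0 := by
    by_contra hne
    have haeval : Polynomial.aeval γ p = 0 := by
      simpa [p, Algebra.algebraMap_ofSubsemiring_apply] using h
    have h1 := Polynomial.natDegree_le_natDegree (minpoly.degree_le_of_ne_zero E γ hne haeval)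
    have h2 : p.natDegree ≤ 2 := Polynomial.natDegree_quadratic_le
    omega
  have h0 := congrArg (Polynomial.coeff · 0) hp
  have h1 := congrArg (Polynomial.coeff · 1) hp
  have h2 := congrArg (Polynomial.coeff · 2) hp
  simp [p, Polynomial.coeff_X, Polynomial.coeff_C, Subtype.ext_iff] at h0 h1 h2
  exact ⟨h2, h1, h0⟩

/-- Two pairs in a commutative domain with equal sum and product agree up to order. -/
theorem eq_or_eq_of_add_eq_of_mul_eq {R : Type*} [CommRing R] [IsDomain R] {a b c d : R}
    (hadd : a + b = c + d) (hmul : a * b = c * d) : a = c ∨ a = d := by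
  have : (a - c) * (a - d) = 0 := by linear_combination a * hadd - hmul
  simpa [sub_eq_zero] using this

theorem exists_mem_eq_mul_of_pow_mul_pow_eq {K : Type*} [Field K] {q k t s : ℕ}
    (hinj : Function.Injective fun x : K => x ^ q)
    (hts : Int.gcd ((t : ℤ) - (s : ℤ)) (k : ℤ) = 1)
    {F : Subfield K} [Finite F] (hF : Nat.card F = q) {u v x y : K}
    (hu : u ^ q ^ k = u) (hx : x ^ q ^ k = x) (hu0 : u ≠ 0) (hv0 : v ≠ 0) (hx0 : x ≠ 0)
    (hmul : u * v = x * y)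
    (h : u ^ q ^ t * v ^ q ^ s = x ^ q ^ t * y ^ q ^ s) :
    ∃ r ∈ F, r ≠ 0 ∧ u = r * x ∧ y = r * v := by
  have hy : y = u / x * v := by field_simp; linear_combination -hmul
  refine ⟨u / x, F.mem_of_pow_card_eq ?_, div_ne_zero hu0 hx0, by field_simp, hy⟩
  rw [hF]
  refine pow_eq_self_of_pow_pow_eq hinj hts (by rw [div_pow, hu, hx]) ?_
  rw [hy, mul_pow, ← mul_assoc] at h
  have h' := mul_right_cancel₀ (pow_ne_zero _ hv0) h
  rw [div_pow, h', mul_div_cancel_left₀ _ (pow_ne_zero _ hx0)]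

/-- For `k ∣ n`, `gcd(t-s, k) = 1`, and `γ` a root of an irreducible
polynomial of degree `n/k > 2` over `F_{q^k}`, the set
`U = {u^{q^t} + u^{q^s}γ : u ∈ F_{q^k}}` is a Sidon space of dimension `k`. -/
theorem sidonSpace_qt_qs {K : Type*} [Field K] (q n k t s : ℕ)
    (hq : IsPrimePow q) (hn : 0 < n) (hk : 0 < k) (ht : 0 < t) (hs : 0 < s)
    (hkn : k ∣ n) (hts : Int.gcd ((t : ℤ) - (s : ℤ)) (k : ℤ) = 1)
    (hK : Nat.card K = q ^ n)
    (F : Subfield K) (hF : Nat.card F = q)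
    (Fk : Subfield K) (hFk : Nat.card Fk = q ^ k) (hFFk : F ≤ Fk)
    (γ : K) (hγ : γ ≠ 0)
    (hdeg : (minpoly Fk γ).natDegree = n / k) (hdeg2 : 2 < n / k) :
    IsSidonSpace F
        (Submodule.span F {x : K | ∃ u ∈ Fk, x = u ^ q ^ t + u ^ q ^ s * γ}) ∧
      Module.finrank F
        ↥(Submodule.span F {x : K | ∃ u ∈ Fk, x = u ^ q ^ t + u ^ q ^ s * γ}) = k := by
  have : Finite K := Nat.finite_of_card_ne_zero (by rw [hK]; exact pow_ne_zero _ hq.ne_zero)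
  have := Fintype.ofFinite K
  have := Fintype.ofFinite F
  have := Fintype.ofFinite Fk
  have hdeg' : 2 < (minpoly Fk γ).natDegree := hdeg ▸ hdeg2
  let σ : K →ₐ[F] K := FiniteField.frobeniusAlgHom F K
  have hσ (m : ℕ) (x : K) : (σ ^ m) x = x ^ q ^ m := by
    rw [AlgHom.coe_pow, ← hF, Nat.card_eq_fintype_card, FiniteField.coe_frobeniusAlgHom,
      pow_iterate]
  have hinj : Function.Injective fun x : K => x ^ q := by
    intro x y hxy
    refine σ.injective ?_
    simpa using (hσ 1 x).trans ((by simpa using hxy : _ = y ^ q ^ 1).trans (hσ 1 y).symm)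
  have hinj_pow (m : ℕ) : Function.Injective fun x : K => x ^ q ^ m := by
    intro x y hxy
    exact (σ ^ m).injective ((hσ m x).trans (hxy.trans (hσ m y).symm))
  have hFk_pow {u : K} (hu : u ∈ Fk) : u ^ q ^ k = u := by
    rw [← hFk, Nat.card_eq_fintype_card]
    exact congrArg Subtype.val (FiniteField.pow_card (⟨u, hu⟩ : Fk))
  let φ : K →ₗ[F] K := (σ ^ t).toLinearMap + LinearMap.mulRight F γ ∘ₗ (σ ^ s).toLinearMap
  have hφ (u : K) : φ u = u ^ q ^ t + u ^ q ^ s * γ := by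
    rw [← hσ, ← hσ]
    rfl
  let W : Submodule F K :=
    { Fk.toAddSubmonoid with
      smul_mem' := fun c x hx => Fk.mul_mem (hFFk c.2) hx }
  have hset : {x : K | ∃ u ∈ Fk, x = u ^ q ^ t + u ^ q ^ s * γ} = (W.map φ : Set K) := by
    ext x
    simp only [Set.mem_ofPred_eq, Submodule.map_coe, Set.mem_image, hφ]
    exact exists_congr fun u => and_congr_right fun _ => eq_comm
  rw [hset, Submodule.span_eq]
  have hφ0 {u : K} (hu : u ∈ Fk) (h : φ u = 0) : u = 0 := by
    rw [hφ] at h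
    have := (Subfield.quadratic_eq_zero hdeg' Fk.zero_mem (Fk.pow_mem hu (q ^ s))
      (Fk.pow_mem hu (q ^ t)) (by linear_combination h)).2.2
    exact eq_zero_of_pow_eq_zero this
  constructor
  · rintro _ ⟨u, hu, rfl⟩ _ ⟨v, hv, rfl⟩ _ ⟨x, hx, rfl⟩ _ ⟨y, hy, rfl⟩ hau hbv hcx hdy h
    change u ∈ Fk at hu
    change v ∈ Fk at hv
    change x ∈ Fk at hx
    change y ∈ Fk at hy
    have hne {z : K} (hz : φ z ≠ 0) : z ≠ 0 := by
      rintro rfl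
      exact hz (map_zero φ)
    have hu0 := hne hau
    have hv0 := hne hbv
    have hx0 := hne hcx
    have hy0 := hne hdy
    have hspan {r z w : K} (hr : r ∈ F) (hr0 : r ≠ 0) (hz : z = r * w) :
        Submodule.span F {φ z} = Submodule.span F {φ w} := by
      have : φ z = (⟨r, hr⟩ : F) • φ w := by
        rw [← map_smul, hz]
        rfl
      rw [this]
      exact Submodule.span_singleton_smul_eq (IsUnit.mk0 _ (by simpa [Subtype.ext_iff] using hr0)) _
    rw [hφ, hφ, hφ, hφ] at h
    have hp {z : K} (hz : z ∈ Fk) (m : ℕ) : z ^ q ^ m ∈ Fk := Fk.pow_mem hz _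
    obtain ⟨-, hmid, hconst⟩ := Subfield.quadratic_eq_zero hdeg'
      (a := u ^ q ^ s * v ^ q ^ s - x ^ q ^ s * y ^ q ^ s)
      (b := u ^ q ^ t * v ^ q ^ s + u ^ q ^ s * v ^ q ^ t -
        (x ^ q ^ t * y ^ q ^ s + x ^ q ^ s * y ^ q ^ t))
      (c := u ^ q ^ t * v ^ q ^ t - x ^ q ^ t * y ^ q ^ t)
      (Fk.sub_mem (Fk.mul_mem (hp hu s) (hp hv s)) (Fk.mul_mem (hp hx s) (hp hy s)))
      (Fk.sub_mem
        (Fk.add_mem (Fk.mul_mem (hp hu t) (hp hv s)) (Fk.mul_mem (hp hu s) (hp hv t)))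
        (Fk.add_mem (Fk.mul_mem (hp hx t) (hp hy s)) (Fk.mul_mem (hp hx s) (hp hy t))))
      (Fk.sub_mem (Fk.mul_mem (hp hu t) (hp hv t)) (Fk.mul_mem (hp hx t) (hp hy t)))
      (by linear_combination h)
    have hmul : u * v = x * y := by
      refine hinj_pow t ?_
      simp only [mul_pow]
      exact sub_eq_zero.1 hconst
    have hprod : (u ^ q ^ t * v ^ q ^ s) * (u ^ q ^ s * v ^ q ^ t) =
        (x ^ q ^ t * y ^ q ^ s) * (x ^ q ^ s * y ^ q ^ t) := by
      calc _ = (u * v) ^ q ^ t * (u * v) ^ q ^ s := by ring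
        _ = (x * y) ^ q ^ t * (x * y) ^ q ^ s := by rw [hmul]
        _ = _ := by ring
    rcases eq_or_eq_of_add_eq_of_mul_eq (sub_eq_zero.1 hmid) hprod with hcase | hcase
    · obtain ⟨r, hr, hr0, hur, hyr⟩ := exists_mem_eq_mul_of_pow_mul_pow_eq hinj hts hF
        (hFk_pow hu) (hFk_pow hx) hu0 hv0 hx0 hmul hcase
      rw [hspan hr hr0 hur, hspan hr hr0 hyr]
    · obtain ⟨r, hr, hr0, hur, hxr⟩ := exists_mem_eq_mul_of_pow_mul_pow_eq hinj hts hF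
        (hFk_pow hu) (hFk_pow hy) hu0 hv0 hy0 (hmul.trans (mul_comm x y))
        (hcase.trans (mul_comm _ _))
      rw [hspan hr hr0 hur, hspan hr hr0 hxr, Set.pair_comm]
  · have hinjOn : Set.InjOn φ W := fun u hu v hv huv =>
      sub_eq_zero.1 (hφ0 (Fk.sub_mem hu hv) (by rw [map_sub, huv, sub_self]))
    have hcard : Nat.card (W.map φ) = q ^ k := by
      rw [← hFk]
      exact Nat.card_image_of_injOn hinjOn
    rw [Module.natCard_eq_pow_finrank (K := F), hF] at hcard
    exact Nat.pow_right_injective hq.two_le hcard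
end

section
/- Let q be a prime power and n, k positive integers with k | n. Let γ ∈ F_{q^n}^* be a root of an irreducible polynomial of degree n/k over F_{q^k}, where n/k > 4, and let δ_1, δ_2 ∈ F_{q^k}^*. Then U = {a + δ_1 u γ + δ_2 u^q γ^2 : a ∈ F_q, u ∈ F_{q^k}} is a Sidon space of F_q-dimension k + 1. -/
open Submodule Pointwise

set_option maxHeartbeats 1000000
set_option synthInstance.maxHeartbeats 400000

namespace SubfieldSidon

variable {K : Type*} [Field K]

/-- The elements of a finite subfield with `q` elements are the solutions of `x ^ q = x`. -/
theorem mem_iff_pow_card_eq_self (F : Subfield K) [Finite F] (x : K) :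
    x ∈ F ↔ x ^ Nat.card F = x := by
  classical
  have := Fintype.ofFinite F
  rw [Nat.card_eq_fintype_card]
  constructor
  · intro hx
    exact congrArg Subtype.val (FiniteField.pow_card (⟨x, hx⟩ : F))
  · intro hx
    have hne : (Polynomial.X ^ Fintype.card F - Polynomial.X : Polynomial F) ≠ 0 :=
      FiniteField.X_pow_card_sub_X_ne_zero F Fintype.one_lt_card
    have hsplit : (Polynomial.X ^ Fintype.card F - Polynomial.X : Polynomial F).Splits := by
      rw [Polynomial.splits_iff_card_roots, FiniteField.roots_X_pow_card_sub_X,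
        FiniteField.X_pow_card_sub_X_natDegree_eq F Fintype.one_lt_card]
      rfl
    obtain ⟨y, hy⟩ : x ∈ (algebraMap F K).range :=
      hsplit.mem_range_of_isRoot hne (by simp [hx])
    exact hy ▸ y.2

theorem add_pow_card (F : Subfield K) [Finite F] (x y : K) :
    (x + y) ^ Nat.card F = x ^ Nat.card F + y ^ Nat.card F := by
  have := Fintype.ofFinite F
  simpa [Nat.card_eq_fintype_card] using map_add (FiniteField.frobeniusAlgHom F K) x y

/-- The coefficients of an expression of degree at most four in `γ` vanish if the expression does
and `γ` has degree more than four. -/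
theorem coeff_eq_zero_of_four_lt_natDegree (L : Subfield K) {γ : K}
    (hγ : 4 < (minpoly L γ).natDegree) {c₀ c₁ c₂ c₃ c₄ : K}
    (h₀ : c₀ ∈ L) (h₁ : c₁ ∈ L) (h₂ : c₂ ∈ L) (h₃ : c₃ ∈ L) (h₄ : c₄ ∈ L)
    (h : c₀ + c₁ * γ + c₂ * γ ^ 2 + c₃ * γ ^ 3 + c₄ * γ ^ 4 = 0) :
    c₀ = 0 ∧ c₁ = 0 ∧ c₂ = 0 ∧ c₃ = 0 ∧ c₄ = 0 := by
  open Polynomial in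
  lift c₀ to L using h₀
  lift c₁ to L using h₁
  lift c₂ to L using h₂
  lift c₃ to L using h₃
  lift c₄ to L using h₄
  set p : L[X] := C c₀ + C c₁ * X + C c₂ * X ^ 2 + C c₃ * X ^ 3 + C c₄ * X ^ 4 with hp
  have hdvd : minpoly L γ ∣ p := minpoly.dvd L γ
    (by simpa [hp, Algebra.algebraMap_eq_smul_one, Subfield.smul_def] using h)
  have hdeg : p.natDegree ≤ 4 := by rw [hp]; compute_degree
  have hp0 : p = 0 := eq_zero_of_dvd_of_natDegree_lt hdvd (hdeg.trans_lt hγ)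
  have hc (i : ℕ) : p.coeff i = 0 := by rw [hp0, coeff_zero]
  have hc₀ := hc 0
  have hc₁ := hc 1
  have hc₂ := hc 2
  have hc₃ := hc 3
  have hc₄ := hc 4
  simp [hp, coeff_X, coeff_C] at hc₀ hc₁ hc₂ hc₃ hc₄
  simp [*]

theorem span_singleton_eq_of_eq_mul (F : Subfield K) {l x y : K} (hl : l ∈ F) (hl0 : l ≠ 0)
    (h : x = l * y) : span F {x} = span F {y} := by
  have hu : IsUnit (⟨l, hl⟩ : F) := isUnit_iff_ne_zero.mpr fun h0 => hl0 (congrArg Subtype.val h0)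
  rw [h, ← span_singleton_smul_eq hu y]
  rfl

/-- Uniqueness of the factorization into linear forms `a + u Y`, where the constant terms lie in `F`.
The last relation makes the scalar lie in `F` also when the constant terms vanish. -/
theorem proportional_of_products_eq (F : Subfield K) [Finite F] {a b c d u v w z : K}
    (ha : a ∈ F) (hb : b ∈ F) (hc : c ∈ F) (hd : d ∈ F)
    (hau : a ≠ 0 ∨ u ≠ 0) (hcw : c ≠ 0 ∨ w ≠ 0) (hdz : d ≠ 0 ∨ z ≠ 0)
    (h₀ : a * b = c * d) (h₁ : a * v + b * u = c * z + d * w) (h₂ : u * v = w * z)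
    (h₃ : u * v ^ Nat.card F + u ^ Nat.card F * v = w * z ^ Nat.card F + w ^ Nat.card F * z) :
    ∃ l ∈ F, l ≠ 0 ∧
      ((c = l * a ∧ w = l * u ∧ b = l * d ∧ v = l * z) ∨
        (d = l * a ∧ z = l * u ∧ b = l * c ∧ v = l * w)) := by
  wlog haw : a * w = c * u generalizing c d w z
  · have hprod : (a * w - c * u) * (a * z - d * u) = 0 := by
      linear_combination (-u ^ 2) * h₀ + a * u * h₁ - a ^ 2 * h₂
    have haz : a * z = d * u :=
      sub_eq_zero.mp ((mul_eq_zero.mp hprod).resolve_left (sub_ne_zero.mpr haw))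
    obtain ⟨l, hl, hl0, h⟩ := this hd hc hdz hcw (h₀.trans (mul_comm c d))
      (h₁.trans (add_comm _ _)) (h₂.trans (mul_comm w z)) (by linear_combination h₃) haz
    exact ⟨l, hl, hl0, h.symm⟩
  by_cases ha0 : a = 0
  · subst ha0
    have hu : u ≠ 0 := hau.resolve_left (not_not.mpr rfl)
    have hc0 : c = 0 := by simpa [hu] using haw
    subst hc0
    have hw : w ≠ 0 := hcw.resolve_left (not_not.mpr rfl)
    by_cases hd0 : d = 0
    · subst hd0
      have hz : z ≠ 0 := hdz.resolve_left (not_not.mpr rfl)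
      have hb0 : b = 0 := by simpa [hu] using h₁
      obtain ⟨l, rfl⟩ : ∃ l, w = l * u := ⟨w / u, by field_simp⟩
      obtain rfl : v = l * z := mul_left_cancel₀ hu (by linear_combination h₂)
      have hl0 : l ≠ 0 := left_ne_zero_of_mul hw
      have hprod : (l ^ Nat.card F - l) * (u * z ^ Nat.card F - u ^ Nat.card F * z) = 0 := by
        simp only [mul_pow] at h₃
        linear_combination h₃
      rcases mul_eq_zero.mp hprod with h | h
      · exact ⟨l, (mem_iff_pow_card_eq_self F l).mpr (sub_eq_zero.mp h), hl0,
          .inl ⟨by simp, rfl, by simp [hb0], rfl⟩⟩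
      · refine ⟨z / u, (mem_iff_pow_card_eq_self F _).mpr ?_, div_ne_zero hz hu,
          .inr ⟨by simp, by field_simp, by simp [hb0], by field_simp⟩⟩
        rw [div_pow, div_eq_div_iff (pow_ne_zero _ hu) hu]
        linear_combination h
    · have hbu : b * u = d * w := by simpa using h₁
      have hb0 : b ≠ 0 := fun h => mul_ne_zero hd0 hw (by rw [← hbu, h, zero_mul])
      have hwu : w = b / d * u := by field_simp; linear_combination -hbu
      refine ⟨b / d, div_mem hb hd, div_ne_zero hb0 hd0, .inl ⟨by simp, hwu, by field_simp, ?_⟩⟩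
      exact mul_left_cancel₀ hu (by rw [h₂, hwu]; ring)
  · have hwu : w = c / a * u := by field_simp; linear_combination haw
    have hc0 : c ≠ 0 := by
      rintro rfl
      exact hcw.elim (· rfl) (· (by simp [hwu]))
    have hbd : b = c / a * d := by field_simp; linear_combination h₀
    refine ⟨c / a, div_mem hc ha, div_ne_zero hc0 ha0, .inl ⟨by field_simp, hwu, hbd, ?_⟩⟩
    refine mul_left_cancel₀ ha0 ?_
    have hca : a * (c / a) = c := by field_simp
    rw [hwu, hbd] at h₁
    linear_combination h₁ - z * hca

/-- The subspace `{a + δ₁ u γ + δ₂ u ^ q γ ^ 2 : a ∈ F, u ∈ L}`, where `q` is the order of `F`. -/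
def frobeniusSubspace (F L : Subfield K) [Finite F] (hFL : F ≤ L) (γ δ₁ δ₂ : K) :
    Submodule F K where
  carrier := {x | ∃ a ∈ F, ∃ u ∈ L, x = a + δ₁ * u * γ + δ₂ * u ^ Nat.card F * γ ^ 2}
  zero_mem' := ⟨0, zero_mem F, 0, zero_mem L, by simp [Nat.card_pos.ne']⟩
  add_mem' := by
    rintro _ _ ⟨a, ha, u, hu, rfl⟩ ⟨b, hb, v, hv, rfl⟩
    refine ⟨a + b, add_mem ha hb, u + v, add_mem hu hv, ?_⟩
    rw [add_pow_card]
    ring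
  smul_mem' := by
    rintro ⟨l, hl⟩ _ ⟨a, ha, u, hu, rfl⟩
    refine ⟨l * a, mul_mem hl ha, l * u, mul_mem (hFL hl) hu, ?_⟩
    rw [mul_pow, (mem_iff_pow_card_eq_self F l).mp hl, Subfield.smul_def, smul_eq_mul]
    ring

variable {F L : Subfield K} [Finite F] (hFL : F ≤ L) {γ δ₁ δ₂ : K}

theorem isSidonSpace_frobeniusSubspace (hγ : 4 < (minpoly L γ).natDegree)
    (hδ₁ : δ₁ ∈ L) (hδ₂ : δ₂ ∈ L) (hδ₁0 : δ₁ ≠ 0) (hδ₂0 : δ₂ ≠ 0) :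
    IsSidonSpace F (frobeniusSubspace F L hFL γ δ₁ δ₂) := by
  rintro _ ⟨a, ha, u, hu, rfl⟩ _ ⟨b, hb, v, hv, rfl⟩ _ ⟨c, hc, w, hw, rfl⟩ _ ⟨d, hd, z, hz, rfl⟩
    hA hB hC hD h
  have hq : Nat.card F ≠ 0 := Nat.card_pos.ne'
  have hpow {l : K} (hl : l ∈ F) : l ^ Nat.card F = l := (mem_iff_pow_card_eq_self F l).mp hl
  have hne {a u : K} (h : a + δ₁ * u * γ + δ₂ * u ^ Nat.card F * γ ^ 2 ≠ 0) : a ≠ 0 ∨ u ≠ 0 := by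
    by_contra! h0
    simp [h0.1, h0.2, hq] at h
  have haL := hFL ha
  have hbL := hFL hb
  have hcL := hFL hc
  have hdL := hFL hd
  set φ : K → K := fun x => x ^ Nat.card F with hφ
  have hφL {x : K} (hx : x ∈ L) : φ x ∈ L := pow_mem hx _
  have huL := hφL hu
  have hvL := hφL hv
  have hwL := hφL hw
  have hzL := hφL hz
  obtain ⟨h₀, h₁, h₂, h₃, -⟩ := coeff_eq_zero_of_four_lt_natDegree L hγ
    (c₀ := a * b - c * d)
    (c₁ := δ₁ * ((a * v + b * u) - (c * z + d * w)))
    (c₂ := δ₂ * ((a * φ v + b * φ u) - (c * φ z + d * φ w)) + δ₁ ^ 2 * (u * v - w * z))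
    (c₃ := δ₁ * δ₂ * ((u * φ v + φ u * v) - (w * φ z + φ w * z)))
    (c₄ := δ₂ ^ 2 * (φ u * φ v - φ w * φ z))
    (sub_mem (mul_mem haL hbL) (mul_mem hcL hdL))
    (mul_mem hδ₁ (sub_mem (add_mem (mul_mem haL hv) (mul_mem hbL hu))
      (add_mem (mul_mem hcL hz) (mul_mem hdL hw))))
    (add_mem (mul_mem hδ₂ (sub_mem (add_mem (mul_mem haL hvL) (mul_mem hbL huL))
      (add_mem (mul_mem hcL hzL) (mul_mem hdL hwL))))
      (mul_mem (pow_mem hδ₁ 2) (sub_mem (mul_mem hu hv) (mul_mem hw hz))))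
    (mul_mem (mul_mem hδ₁ hδ₂) (sub_mem (add_mem (mul_mem hu hvL) (mul_mem huL hv))
      (add_mem (mul_mem hw hzL) (mul_mem hwL hz))))
    (mul_mem (pow_mem hδ₂ 2) (sub_mem (mul_mem huL hvL) (mul_mem hwL hzL)))
    (by simp only [hφ]; linear_combination h)
  replace h₀ := sub_eq_zero.mp h₀
  replace h₁ := sub_eq_zero.mp ((mul_eq_zero.mp h₁).resolve_left hδ₁0)
  replace h₃ := sub_eq_zero.mp ((mul_eq_zero.mp h₃).resolve_left (mul_ne_zero hδ₁0 hδ₂0))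
  have hfrob : a * φ v + b * φ u = c * φ z + d * φ w := by
    have := congrArg φ h₁
    simpa only [hφ, add_pow_card, mul_pow, hpow ha, hpow hb, hpow hc, hpow hd] using this
  rw [hfrob, sub_self, mul_zero, zero_add] at h₂
  replace h₂ := sub_eq_zero.mp ((mul_eq_zero.mp h₂).resolve_left (pow_ne_zero 2 hδ₁0))
  have hspan {l x y s t : K} (hl : l ∈ F) (hl0 : l ≠ 0) (hx : x = l * y) (hs : s = l * t) :
      span F {x + δ₁ * s * γ + δ₂ * s ^ Nat.card F * γ ^ 2} =
        span F {y + δ₁ * t * γ + δ₂ * t ^ Nat.card F * γ ^ 2} := by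
    refine span_singleton_eq_of_eq_mul F hl hl0 ?_
    rw [hx, hs, mul_pow, hpow hl]
    ring
  obtain ⟨l, hl, hl0, ⟨hca, hwu, hbd, hvz⟩ | ⟨hda, hzu, hbc, hvw⟩⟩ :=
    proportional_of_products_eq F ha hb hc hd (hne hA) (hne hC) (hne hD) h₀ h₁ h₂ h₃
  · rw [hspan hl hl0 hca hwu, hspan hl hl0 hbd hvz]
  · rw [hspan hl hl0 hda hzu, hspan hl hl0 hbc hvw, Set.pair_comm]

theorem natCard_frobeniusSubspace (hγ : 4 < (minpoly L γ).natDegree)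
    (hδ₁ : δ₁ ∈ L) (hδ₂ : δ₂ ∈ L) (hδ₁0 : δ₁ ≠ 0) :
    Nat.card (frobeniusSubspace F L hFL γ δ₁ δ₂) = Nat.card F * Nat.card L := by
  rw [← Nat.card_prod]
  refine (Nat.card_eq_of_bijective (fun x : F × L =>
    (⟨x.1 + δ₁ * x.2 * γ + δ₂ * x.2 ^ Nat.card F * γ ^ 2, x.1, x.1.2, x.2, x.2.2, rfl⟩ :
      frobeniusSubspace F L hFL γ δ₁ δ₂)) ⟨?_, ?_⟩).symm
  · rintro ⟨⟨a, ha⟩, u, hu⟩ ⟨⟨b, hb⟩, v, hv⟩ h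
    replace h : a + δ₁ * u * γ + δ₂ * u ^ Nat.card F * γ ^ 2 =
      b + δ₁ * v * γ + δ₂ * v ^ Nat.card F * γ ^ 2 := congrArg Subtype.val h
    obtain ⟨h₀, h₁, -⟩ := coeff_eq_zero_of_four_lt_natDegree L hγ
      (c₀ := a - b) (c₁ := δ₁ * (u - v)) (c₂ := δ₂ * (u ^ Nat.card F - v ^ Nat.card F))
      (sub_mem (hFL ha) (hFL hb)) (mul_mem hδ₁ (sub_mem hu hv))
      (mul_mem hδ₂ (sub_mem (pow_mem hu _) (pow_mem hv _))) (zero_mem L) (zero_mem L)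
      (by linear_combination h)
    obtain rfl := sub_eq_zero.mp h₀
    obtain rfl := sub_eq_zero.mp ((mul_eq_zero.mp h₁).resolve_left hδ₁0)
    rfl
  · rintro ⟨_, a, ha, u, hu, rfl⟩
    exact ⟨(⟨a, ha⟩, ⟨u, hu⟩), rfl⟩

end SubfieldSidon

/-- For `k ∣ n`, `γ` a root of an irreducible polynomial of degree
`n/k > 4` over `F_{q^k}`, and `δ₁, δ₂ ∈ F_{q^k}^*`, the set
`U = {a + δ₁uγ + δ₂uᑫγ² : a ∈ F_q, u ∈ F_{q^k}}` is a Sidon space of dimension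
`k + 1`. -/
theorem sidonSpace_a_ugamma_uqgammasq {K : Type*} [Field K] (q n k : ℕ)
    (hq : IsPrimePow q) (hn : 0 < n) (hk : 0 < k) (hkn : k ∣ n)
    (hK : Nat.card K = q ^ n)
    (F : Subfield K) (hF : Nat.card F = q)
    (Fk : Subfield K) (hFk : Nat.card Fk = q ^ k) (hFFk : F ≤ Fk)
    (γ : K) (hγ : γ ≠ 0)
    (hdeg : (minpoly Fk γ).natDegree = n / k) (hdeg4 : 4 < n / k)
    (δ₁ δ₂ : K) (hδ₁ : δ₁ ∈ Fk) (hδ₂ : δ₂ ∈ Fk) (hδ₁0 : δ₁ ≠ 0) (hδ₂0 : δ₂ ≠ 0) :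
    IsSidonSpace F
        (Submodule.span F
          {x : K | ∃ a ∈ F, ∃ u ∈ Fk, x = a + δ₁ * u * γ + δ₂ * u ^ q * γ ^ 2}) ∧
      Module.finrank F
        ↥(Submodule.span F
          {x : K | ∃ a ∈ F, ∃ u ∈ Fk, x = a + δ₁ * u * γ + δ₂ * u ^ q * γ ^ 2}) = k + 1 := by
  have hKfin : Finite K :=
    Nat.finite_of_card_ne_zero (hK ▸ pow_ne_zero n hq.pos.ne')
  have hγ4 : 4 < (minpoly Fk γ).natDegree := hdeg ▸ hdeg4
  have hspan : span F {x : K | ∃ a ∈ F, ∃ u ∈ Fk, x = a + δ₁ * u * γ + δ₂ * u ^ q * γ ^ 2} =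
      SubfieldSidon.frobeniusSubspace F Fk hFFk γ δ₁ δ₂ := by
    rw [← hF]
    exact span_eq (SubfieldSidon.frobeniusSubspace F Fk hFFk γ δ₁ δ₂)
  rw [hspan]
  refine ⟨SubfieldSidon.isSidonSpace_frobeniusSubspace hFFk hγ4 hδ₁ hδ₂ hδ₁0 hδ₂0, ?_⟩
  have hcard := SubfieldSidon.natCard_frobeniusSubspace hFFk hγ4 hδ₁ hδ₂ hδ₁0
  rw [Module.natCard_eq_pow_finrank (K := F), hF, hFk, ← pow_succ'] at hcard
  exact Nat.pow_right_injective hq.one_lt hcard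
end

section
/- Let q be a prime power and n, k, l positive integers with kl | n and gcd(k, l) = 1. Let γ ∈ F_{q^n}^* be a root of an irreducible polynomial of degree n/(kl) over F_{q^{kl}}, where n/(kl) > 6, and let δ_1, δ_2 ∈ F_{q^k}^* and τ_1, τ_2 ∈ F_{q^l}^*. Then U = {δ_1 a + τ_1 u γ + δ_2 a^q γ^2 + τ_2 u^q γ^3 : a ∈ F_{q^k}, u ∈ F_{q^l}} is a Sidon space of F_q-dimension k + l. -/
open Submodule Pointwise

set_option maxHeartbeats 1000000
set_option synthInstance.maxHeartbeats 400000

/-- The pairs `(a, u), (b, v)` are rescaled to `(c, w), (d, z)` by mutually inverse scalars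
of `F`. -/
def AreRescaled {K : Type*} [Field K] (F : Subfield K) (a u b v c w d z : K) : Prop :=
  ∃ s ∈ F, s ≠ 0 ∧ c = s * a ∧ w = s * u ∧ s * d = b ∧ s * z = v

section Rescaled

variable {K : Type*} [Field K] {F Fk Fl : Subfield K} {a u b v c w d z : K} {q : ℕ}

lemma AreRescaled.swap (h : AreRescaled F a u b v d z c w) : AreRescaled F b v a u c w d z := by
  obtain ⟨s, hs, h0, rfl, rfl, rfl, rfl⟩ := h
  exact ⟨s⁻¹, F.inv_mem hs, inv_ne_zero h0, by field_simp, by field_simp, by field_simp,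
    by field_simp⟩

lemma AreRescaled.transpose (h : AreRescaled F u a v b w c z d) :
    AreRescaled F a u b v c w d z := by
  obtain ⟨s, hs, h0, h1, h2, h3, h4⟩ := h
  exact ⟨s, hs, h0, h2, h1, h4, h3⟩

/-- The sum and product relations for `x ↦ x ^ (q - 1)` determine `a, b` up to scalars of `F`. -/
lemma exists_scalar_of_mul_eq (hF : ∀ x : K, x ^ q = x → x ∈ F) (ha : a ≠ 0) (hb : b ≠ 0)
    (h0 : a * b = c * d) (h1 : a * b ^ q + a ^ q * b = c * d ^ q + c ^ q * d) :
    (∃ s ∈ F, s ≠ 0 ∧ c = s * a ∧ s * d = b) ∨ (∃ s ∈ F, s ≠ 0 ∧ c = s * b ∧ s * d = a) := by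
  have hc : c ≠ 0 := by
    rintro rfl
    simp_all
  have h2 : a ^ q * b ^ q = c ^ q * d ^ q := by rw [← mul_pow, h0, mul_pow]
  have h3 : (a * c ^ q - a ^ q * c) * (b * c ^ q - b ^ q * c) = 0 := by
    linear_combination c ^ (2 * q) * h0 - c ^ q * c * h1 + c ^ 2 * h2
  rcases mul_eq_zero.1 h3 with h | h
  · refine Or.inl ⟨c / a, hF _ ?_, div_ne_zero hc ha, by field_simp, ?_⟩
    · rw [div_pow]
      field_simp
      linear_combination h
    · field_simp
      linear_combination -h0
  · refine Or.inr ⟨c / b, hF _ ?_, div_ne_zero hc hb, by field_simp, ?_⟩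
    · rw [div_pow]
      field_simp
      linear_combination h
    · field_simp
      linear_combination -h0

lemma areRescaled_of_eq_zero_of_eq_zero (hF : ∀ x : K, x ^ q = x → x ∈ F)
    (hkl : ∀ x ∈ Fk, x ∈ Fl → x ∈ F)
    (hb : b ∈ Fk) (hd : d ∈ Fk) (hu : u ∈ Fl) (hw : w ∈ Fl)
    (hu0 : u ≠ 0) (hbv : b ≠ 0 ∨ v ≠ 0) (hw0 : w ≠ 0)
    (hmul : u * v = w * z) (hq : u * v ^ q + u ^ q * v = w * z ^ q + w ^ q * z)
    (hmix : b * u = d * w) :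
    AreRescaled F 0 u b v 0 w d z ∨ AreRescaled F b v 0 u 0 w d z := by
  by_cases hb0 : b = 0
  · subst hb0
    obtain rfl : d = 0 := by simpa [hw0] using hmix.symm
    have hv0 : v ≠ 0 := by simpa using hbv
    rcases exists_scalar_of_mul_eq hF hu0 hv0 hmul hq with ⟨s, hs, h0, h1, h2⟩ | ⟨s, hs, h0, h1, h2⟩
    · exact Or.inl ⟨s, hs, h0, by simp, h1, by simp, h2⟩
    · exact Or.inr ⟨s, hs, h0, by simp, h1, by simp, h2⟩
  · have hd0 : d ≠ 0 := by
      rintro rfl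
      simp_all
    have hs : w / u = b / d := by
      field_simp
      linear_combination -hmix
    refine Or.inl ⟨w / u, hkl _ (hs ▸ Fk.div_mem hb hd) (Fl.div_mem hw hu), div_ne_zero hw0 hu0,
      by simp, by field_simp, ?_, ?_⟩
    · rw [hs]
      field_simp
    · field_simp
      linear_combination -hmul

lemma areRescaled_of_eq_zero (hF : ∀ x : K, x ^ q = x → x ∈ F)
    (hkl : ∀ x ∈ Fk, x ∈ Fl → x ∈ F)
    (hb : b ∈ Fk) (hc : c ∈ Fk) (hd : d ∈ Fk) (hu : u ∈ Fl) (hw : w ∈ Fl) (hz : z ∈ Fl)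
    (hu0 : u ≠ 0) (hbv : b ≠ 0 ∨ v ≠ 0) (hcw : c ≠ 0 ∨ w ≠ 0) (hdz : d ≠ 0 ∨ z ≠ 0)
    (hcd : c * d = 0) (hmul : u * v = w * z)
    (hq : u * v ^ q + u ^ q * v = w * z ^ q + w ^ q * z)
    (hmix : b * u = c * z + d * w) :
    AreRescaled F 0 u b v c w d z ∨ AreRescaled F b v 0 u c w d z := by
  rcases mul_eq_zero.1 hcd with rfl | rfl
  · exact areRescaled_of_eq_zero_of_eq_zero hF hkl hb hd hu hw hu0 hbv (by simpa using hcw)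
      hmul hq (by linear_combination hmix)
  · exact (areRescaled_of_eq_zero_of_eq_zero hF hkl hb hc hu hz hu0 hbv (by simpa using hdz)
      (by linear_combination hmul) (by linear_combination hq)
      (by linear_combination hmix)).symm.imp .swap .swap

lemma areRescaled_of_exists_scalar (hF : ∀ x : K, x ^ q = x → x ∈ F)
    (hkl : ∀ x ∈ Fk, x ∈ Fl → x ∈ F)
    (ha : a ∈ Fk) (hd : d ∈ Fk) (hu : u ∈ Fl) (hz : z ∈ Fl)
    (ha0 : a ≠ 0) (hb0 : b ≠ 0) (hu0 : u ≠ 0) (hv0 : v ≠ 0)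
    (hmul : u * v = w * z) (hq : u * v ^ q + u ^ q * v = w * z ^ q + w ^ q * z)
    (hmix : a * v + b * u = c * z + d * w)
    (hs : ∃ s ∈ F, s ≠ 0 ∧ c = s * a ∧ s * d = b) :
    AreRescaled F a u b v c w d z ∨ AreRescaled F b v a u c w d z := by
  obtain ⟨s, hs, hs0, rfl, rfl⟩ := hs
  have hd0 : d ≠ 0 := right_ne_zero_of_mul hb0
  rcases exists_scalar_of_mul_eq hF hu0 hv0 hmul hq with
    ⟨t, ht, ht0, rfl, rfl⟩ | ⟨t, ht, ht0, rfl, rfl⟩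
  · have hz0 : z ≠ 0 := right_ne_zero_of_mul hv0
    have key : (s - t) * (d * u - a * z) = 0 := by linear_combination hmix
    rcases mul_eq_zero.1 key with h | h
    · obtain rfl := sub_eq_zero.1 h
      exact Or.inl ⟨s, hs, hs0, rfl, rfl, rfl, rfl⟩
    · have hr : a / d = u / z := by
        field_simp
        linear_combination -h
      refine Or.inr ⟨a / d, hkl _ (Fk.div_mem ha hd) (hr ▸ Fl.div_mem hu hz),
        div_ne_zero ha0 hd0, by field_simp, ?_, by field_simp, ?_⟩
      · rw [hr]
        field_simp
      · rw [hr]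
        field_simp
  · have key : (a - t * d) * (v - s * z) = 0 := by linear_combination hmix
    rcases mul_eq_zero.1 key with h | h
    · obtain rfl := sub_eq_zero.1 h
      exact Or.inr ⟨t, ht, ht0, by ring, rfl, rfl, rfl⟩
    · obtain rfl := sub_eq_zero.1 h
      exact Or.inl ⟨s, hs, hs0, rfl, by ring, rfl, rfl⟩

/-- Unique factorization of the products `(a, u) * (b, v)`, from the coefficient relations. -/
lemma areRescaled_of_coeff_eq (hF : ∀ x : K, x ^ q = x → x ∈ F)
    (hkl : ∀ x ∈ Fk, x ∈ Fl → x ∈ F)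
    (ha : a ∈ Fk) (hb : b ∈ Fk) (hc : c ∈ Fk) (hd : d ∈ Fk)
    (hu : u ∈ Fl) (hv : v ∈ Fl) (hw : w ∈ Fl) (hz : z ∈ Fl)
    (hau : a ≠ 0 ∨ u ≠ 0) (hbv : b ≠ 0 ∨ v ≠ 0) (hcw : c ≠ 0 ∨ w ≠ 0) (hdz : d ≠ 0 ∨ z ≠ 0)
    (hmul : a * b = c * d) (hmul' : u * v = w * z)
    (hq : a * b ^ q + a ^ q * b = c * d ^ q + c ^ q * d)
    (hq' : u * v ^ q + u ^ q * v = w * z ^ q + w ^ q * z)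
    (hmix : a * v + b * u = c * z + d * w) :
    AreRescaled F a u b v c w d z ∨ AreRescaled F b v a u c w d z := by
  have hlk : ∀ x ∈ Fl, x ∈ Fk → x ∈ F := fun x h h' ↦ hkl x h' h
  by_cases ha0 : a = 0
  · subst ha0
    exact areRescaled_of_eq_zero hF hkl hb hc hd hu hw hz (by simpa using hau) hbv hcw hdz
      (by linear_combination -hmul) hmul' hq' (by linear_combination hmix)
  by_cases hb0 : b = 0
  · subst hb0
    exact (areRescaled_of_eq_zero hF hkl ha hc hd hv hw hz (by simpa using hbv) hau hcw hdz
      (by linear_combination -hmul) (by linear_combination hmul') (by linear_combination hq')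
      (by linear_combination hmix)).symm
  by_cases hu0 : u = 0
  · subst hu0
    exact (areRescaled_of_eq_zero hF hlk hv hw hz ha hc hd ha0 hbv.symm hcw.symm hdz.symm
      (by linear_combination -hmul') hmul hq (by linear_combination hmix)).imp
      .transpose .transpose
  by_cases hv0 : v = 0
  · subst hv0
    exact (areRescaled_of_eq_zero hF hlk hu hw hz hb hc hd hb0 hau.symm hcw.symm hdz.symm
      (by linear_combination -hmul') (by linear_combination hmul) (by linear_combination hq)
      (by linear_combination hmix)).symm.imp .transpose .transpose
  rcases exists_scalar_of_mul_eq hF ha0 hb0 hmul hq with h | h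
  · exact areRescaled_of_exists_scalar hF hkl ha hd hu hz ha0 hb0 hu0 hv0 hmul' hq' hmix h
  · exact (areRescaled_of_exists_scalar hF hkl hb hd hv hz hb0 ha0 hv0 hu0
      (by linear_combination hmul') (by linear_combination hq') (by linear_combination hmix) h).symm

end Rescaled

section FiniteField

variable {K : Type*} [Field K] {q : ℕ}

lemma Subfield.pow_natCard_eq (L : Subfield K) (hL : 0 < Nat.card L) {x : K} (hx : x ∈ L) :
    x ^ Nat.card L = x := by
  have : Finite L := Nat.finite_of_card_ne_zero hL.ne'
  have := Fintype.ofFinite L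
  rw [Nat.card_eq_fintype_card]
  exact congrArg Subtype.val (FiniteField.pow_card (⟨x, hx⟩ : L))

lemma Subfield.mem_of_pow_natCard_eq (L : Subfield K) (hL : 1 < Nat.card L) {x : K}
    (hx : x ^ Nat.card L = x) : x ∈ L := by
  classical
  have : Finite L := Nat.finite_of_card_ne_zero (by omega)
  have hfin : (L : Set K).Finite := this
  have hP := FiniteField.X_pow_card_sub_X_ne_zero K hL
  have hroots : hfin.toFinset = (Polynomial.X ^ Nat.card L - Polynomial.X :
      Polynomial K).roots.toFinset := by
    refine Finset.eq_of_subset_of_card_le (fun y hy ↦ ?_) ?_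
    · have := L.pow_natCard_eq (by omega) (x := y) (by simpa using hy)
      simp [hP, this]
    · refine (Multiset.toFinset_card_le _).trans ((Polynomial.card_roots' _).trans ?_)
      rw [FiniteField.X_pow_card_sub_X_natDegree_eq K hL, ← Set.ncard_eq_toFinset_card _ hfin]
      rfl
  have : x ∈ hfin.toFinset := by
    rw [hroots]
    simp [hP, hx]
  simpa using this

lemma pow_eq_self_of_coprime {k l : ℕ} (hkl : k.Coprime l) {x : K}
    (hxk : x ^ q ^ k = x) (hxl : x ^ q ^ l = x) : x ^ q = x := by
  have h (m : ℕ) : (fun y : K ↦ y ^ q)^[m] x = x ^ q ^ m := by simp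
  have hk : Function.IsPeriodicPt (fun y : K ↦ y ^ q) k x := (h k).trans hxk
  have hl : Function.IsPeriodicPt (fun y : K ↦ y ^ q) l x := (h l).trans hxl
  have := hk.gcd hl
  rw [hkl.gcd_eq_one] at this
  exact this

lemma add_pow_of_natCard_eq_pow [Finite K] {n : ℕ} (hq : IsPrimePow q) (hn : n ≠ 0)
    (hK : Nat.card K = q ^ n) (x y : K) : (x + y) ^ q = x ^ q + y ^ q := by
  obtain ⟨p, m, hp, hm, rfl⟩ := hq
  have hp' : p.Prime := hp.nat_prime
  have : Fact p.Prime := ⟨hp'⟩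
  have : Fintype K := Fintype.ofFinite K
  have : CharP K p := by
    have h0 : ((p : ℕ) : K) = 0 := by
      have := FiniteField.cast_card_eq_zero K
      rw [← Nat.card_eq_fintype_card, hK, ← pow_mul, Nat.cast_pow] at this
      exact pow_eq_zero_iff (by positivity) |>.1 this
    obtain ⟨r, hr⟩ := CharP.exists K
    rcases (Nat.dvd_prime hp').1 ((CharP.cast_eq_zero_iff K r p).1 h0) with rfl | rfl
    · exact absurd rfl (CharP.char_ne_one K 1)
    · exact hr
  exact add_pow_char_pow x y p m

lemma coeff_eq_zero_of_lt_natDegree_minpoly (L : Subfield K) {γ : K} {m : ℕ}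
    (hm : m ≤ (minpoly L γ).natDegree) (e : Fin m → K) (he : ∀ i, e i ∈ L)
    (h : ∑ i, e i * γ ^ (i : ℕ) = 0) (i : Fin m) : e i = 0 := by
  have hli := (linearIndependent_pow (K := L) γ).comp (Fin.castLE hm) (Fin.castLE_injective hm)
  have := Fintype.linearIndependent_iff.1 hli (fun i ↦ ⟨e i, he i⟩)
    (by simpa [Subfield.smul_def] using h) i
  simpa using congrArg Subtype.val this

end FiniteField

/-- For `kl ∣ n`, `gcd(k,l) = 1`, `γ` a root of an irreducible polynomial of
degree `n/(kl) > 6` over `F_{q^{kl}}`, `δ₁, δ₂ ∈ F_{q^k}^*`, `τ₁, τ₂ ∈ F_{q^l}^*`, the set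
`U = {δ₁a + τ₁uγ + δ₂aᑫγ² + τ₂uᑫγ³ : a ∈ F_{q^k}, u ∈ F_{q^l}}` is a Sidon space of
dimension `k + l`. -/
theorem sidonSpace_sum_two_nontrivial {K : Type*} [Field K] (q n k l : ℕ)
    (hq : IsPrimePow q) (hn : 0 < n) (hk : 0 < k) (hl : 0 < l)
    (hkl : Nat.Coprime k l) (hkln : k * l ∣ n)
    (hK : Nat.card K = q ^ n)
    (F : Subfield K) (hF : Nat.card F = q)
    (Fk : Subfield K) (hFk : Nat.card Fk = q ^ k) (hFFk : F ≤ Fk)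
    (Fl : Subfield K) (hFl : Nat.card Fl = q ^ l) (hFFl : F ≤ Fl)
    (Fkl : Subfield K) (hFkl : Nat.card Fkl = q ^ (k * l))
    (hFkFkl : Fk ≤ Fkl) (hFlFkl : Fl ≤ Fkl)
    (γ : K) (hγ : γ ≠ 0)
    (hdeg : (minpoly Fkl γ).natDegree = n / (k * l)) (hdeg6 : 6 < n / (k * l))
    (δ₁ δ₂ : K) (hδ₁ : δ₁ ∈ Fk) (hδ₂ : δ₂ ∈ Fk) (hδ₁0 : δ₁ ≠ 0) (hδ₂0 : δ₂ ≠ 0)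
    (τ₁ τ₂ : K) (hτ₁ : τ₁ ∈ Fl) (hτ₂ : τ₂ ∈ Fl) (hτ₁0 : τ₁ ≠ 0) (hτ₂0 : τ₂ ≠ 0) :
    IsSidonSpace F
        (Submodule.span F
          {x : K | ∃ a ∈ Fk, ∃ u ∈ Fl,
            x = δ₁ * a + τ₁ * u * γ + δ₂ * a ^ q * γ ^ 2 + τ₂ * u ^ q * γ ^ 3}) ∧
      Module.finrank F
        ↥(Submodule.span F
          {x : K | ∃ a ∈ Fk, ∃ u ∈ Fl,
            x = δ₁ * a + τ₁ * u * γ + δ₂ * a ^ q * γ ^ 2 + τ₂ * u ^ q * γ ^ 3}) = k + l := by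
  have hq1 : 1 < q := hq.one_lt
  have hfin : Finite K := Nat.finite_of_card_ne_zero (by rw [hK]; positivity)
  have hadd : ∀ x y : K, (x + y) ^ q = x ^ q + y ^ q :=
    add_pow_of_natCard_eq_pow hq hn.ne' hK
  have hFq : ∀ x ∈ F, x ^ q = x := fun x hx ↦ by
    simpa [hF] using F.pow_natCard_eq (by omega) hx
  have hFmem : ∀ x : K, x ^ q = x → x ∈ F := fun x hx ↦
    F.mem_of_pow_natCard_eq (by omega) (by rwa [hF])
  have hinter : ∀ x ∈ Fk, x ∈ Fl → x ∈ F := fun x hxk hxl ↦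
    hFmem x (pow_eq_self_of_coprime hkl
      (by simpa only [hFk] using Fk.pow_natCard_eq Nat.card_pos hxk)
      (by simpa only [hFl] using Fl.pow_natCard_eq Nat.card_pos hxl))
  set f : K → K → K := fun a u ↦ δ₁ * a + τ₁ * u * γ + δ₂ * a ^ q * γ ^ 2 + τ₂ * u ^ q * γ ^ 3
    with hf
  have hf_add (a b u v : K) : f a u + f b v = f (a + b) (u + v) := by
    simp only [hf, hadd]
    ring
  have hf_smul (s : K) (hs : s ∈ F) (a u : K) : s * f a u = f (s * a) (s * u) := by
    simp only [hf, mul_pow, hFq s hs]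
    ring
  have hf_zero : f 0 0 = 0 := by simp [hf, zero_pow (by omega : q ≠ 0)]
  have hδ₁' := hFkFkl hδ₁
  have hδ₂' := hFkFkl hδ₂
  have hτ₁' := hFlFkl hτ₁
  have hτ₂' := hFlFkl hτ₂
  have hf_eq_zero {a u : K} (ha : a ∈ Fk) (hu : u ∈ Fl) (h : f a u = 0) : a = 0 ∧ u = 0 := by
    have ha' := hFkFkl ha
    have hu' := hFlFkl hu
    have hc := coeff_eq_zero_of_lt_natDegree_minpoly Fkl (γ := γ) (m := 4) (by omega)
      ![δ₁ * a, τ₁ * u, δ₂ * a ^ q, τ₂ * u ^ q]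
      (by
        simp only [Fin.forall_fin_succ, Matrix.cons_val_zero, Matrix.cons_val_succ]
        clear hFmem hinter hFFk hFFl hFkFkl hFlFkl
        refine ⟨?_, ?_, ?_, ?_, fun i ↦ i.elim0⟩ <;> apply_rules [mul_mem, pow_mem])
      (by simpa [Fin.sum_univ_succ, hf, add_assoc] using h)
    exact ⟨by simpa [hδ₁0] using hc 0, by simpa [hτ₁0] using hc 1⟩
  have hf_sub (a b u v : K) : f a u - f b v = f (a - b) (u - v) := by
    rw [sub_eq_iff_eq_add, hf_add, sub_add_cancel, sub_add_cancel]
  have hf_inj {a u b v : K} (ha : a ∈ Fk) (hu : u ∈ Fl) (hb : b ∈ Fk) (hv : v ∈ Fl)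
      (h : f a u = f b v) : a = b ∧ u = v := by
    simpa [sub_eq_zero] using
      hf_eq_zero (Fk.sub_mem ha hb) (Fl.sub_mem hu hv) (by rw [← hf_sub, h, sub_self])
  have hf_mul {a u b v c w d z : K} (ha : a ∈ Fk) (hu : u ∈ Fl) (hb : b ∈ Fk) (hv : v ∈ Fl)
      (hc : c ∈ Fk) (hw : w ∈ Fl) (hd : d ∈ Fk) (hz : z ∈ Fl)
      (h : f a u * f b v = f c w * f d z) :
      a * b = c * d ∧ u * v = w * z ∧ a * b ^ q + a ^ q * b = c * d ^ q + c ^ q * d ∧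
        u * v ^ q + u ^ q * v = w * z ^ q + w ^ q * z ∧ a * v + b * u = c * z + d * w := by
    have ha' := hFkFkl ha
    have hb' := hFkFkl hb
    have hc' := hFkFkl hc
    have hd' := hFkFkl hd
    have hu' := hFlFkl hu
    have hv' := hFlFkl hv
    have hw' := hFlFkl hw
    have hz' := hFlFkl hz
    have H := coeff_eq_zero_of_lt_natDegree_minpoly Fkl (γ := γ) (m := 7) (by omega)
      ![δ₁ * δ₁ * (a * b - c * d),
        δ₁ * τ₁ * (a * v + b * u - (c * z + d * w)),
        δ₁ * δ₂ * (a * b ^ q + a ^ q * b - (c * d ^ q + c ^ q * d)) +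
          τ₁ * τ₁ * (u * v - w * z),
        δ₁ * τ₂ * (a * v ^ q + b * u ^ q - (c * z ^ q + d * w ^ q)) +
          δ₂ * τ₁ * (a ^ q * v + b ^ q * u - (c ^ q * z + d ^ q * w)),
        δ₂ * δ₂ * ((a * b) ^ q - (c * d) ^ q) +
          τ₁ * τ₂ * (u * v ^ q + u ^ q * v - (w * z ^ q + w ^ q * z)),
        δ₂ * τ₂ * (a ^ q * v ^ q + b ^ q * u ^ q - (c ^ q * z ^ q + d ^ q * w ^ q)),
        τ₂ * τ₂ * ((u * v) ^ q - (w * z) ^ q)]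
      (by
        simp only [Fin.forall_fin_succ, Matrix.cons_val_zero, Matrix.cons_val_succ]
        clear hFmem hinter hFFk hFFl hFkFkl hFlFkl
        refine ⟨?_, ?_, ?_, ?_, ?_, ?_, ?_, fun i ↦ i.elim0⟩ <;>
          apply_rules [mul_mem, pow_mem, add_mem, sub_mem])
      (by
        simp only [hf] at h
        simp [Fin.sum_univ_seven]
        linear_combination h)
    have h0 : a * b = c * d := by simpa [hδ₁0, sub_eq_zero] using H 0
    have h1 : a * v + b * u = c * z + d * w := by simpa [hδ₁0, hτ₁0, sub_eq_zero] using H 1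
    have h6 : (u * v) ^ q = (w * z) ^ q := by simpa [hτ₂0, sub_eq_zero] using H 6
    have h6' : u * v = w * z := by
      have h := hadd (u * v - w * z) (w * z)
      rw [sub_add_cancel, h6, right_eq_add] at h
      exact sub_eq_zero.1 (eq_zero_of_pow_eq_zero h)
    have h2 : a * b ^ q + a ^ q * b = c * d ^ q + c ^ q * d := by
      simpa [hδ₁0, hδ₂0, h6', sub_eq_zero] using H 2
    have h4 : u * v ^ q + u ^ q * v = w * z ^ q + w ^ q * z := by
      simpa [hτ₁0, hτ₂0, h0, sub_eq_zero] using H 4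
    exact ⟨h0, h6', h2, h4, h1⟩
  let U : Submodule F K :=
    { carrier := {x : K | ∃ a ∈ Fk, ∃ u ∈ Fl, x = f a u}
      add_mem' := by
        rintro _ _ ⟨a, ha, u, hu, rfl⟩ ⟨b, hb, v, hv, rfl⟩
        exact ⟨a + b, add_mem ha hb, u + v, add_mem hu hv, hf_add a b u v⟩
      zero_mem' := ⟨0, zero_mem _, 0, zero_mem _, hf_zero.symm⟩
      smul_mem' := by
        rintro s _ ⟨a, ha, u, hu, rfl⟩
        exact ⟨s * a, mul_mem (hFFk s.2) ha, s * u, mul_mem (hFFl s.2) hu, hf_smul s s.2 a u⟩ }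
  have hU : Submodule.span F {x : K | ∃ a ∈ Fk, ∃ u ∈ Fl, x = f a u} = U := span_eq U
  rw [hU]
  have hspan (s : K) (hs : s ∈ F) (hs0 : s ≠ 0) (a u : K) :
      Submodule.span F {f (s * a) (s * u)} = Submodule.span F {f a u} := by
    rw [← hf_smul s hs]
    exact span_singleton_smul_eq (R := F) (r := ⟨s, hs⟩)
      (IsUnit.mk0 _ (by simpa [Subtype.ext_iff] using hs0)) (f a u)
  have hpair {a u b v c w d z : K} (h : AreRescaled F a u b v c w d z) :
      Submodule.span F {f a u} = Submodule.span F {f c w} ∧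
        Submodule.span F {f b v} = Submodule.span F {f d z} := by
    obtain ⟨s, hs, hs0, rfl, rfl, rfl, rfl⟩ := h
    exact ⟨(hspan s hs hs0 a u).symm, hspan s hs hs0 d z⟩
  refine ⟨?_, ?_⟩
  · rintro _ ⟨a, ha, u, hu, rfl⟩ _ ⟨b, hb, v, hv, rfl⟩ _ ⟨c, hc, w, hw, rfl⟩
      _ ⟨d, hd, z, hz, rfl⟩ h1 h2 h3 h4 h
    have hne {a u : K} (h : f a u ≠ 0) : a ≠ 0 ∨ u ≠ 0 := by
      by_contra! h'
      exact h (by rw [h'.1, h'.2, hf_zero])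
    obtain ⟨e1, e2, e3, e4, e5⟩ := hf_mul ha hu hb hv hc hw hd hz h
    rcases areRescaled_of_coeff_eq hFmem hinter ha hb hc hd hu hv hw hz (hne h1) (hne h2)
      (hne h3) (hne h4) e1 e2 e3 e4 e5 with h | h
    · rw [(hpair h).1, (hpair h).2]
    · rw [(hpair h).1, (hpair h).2, Set.pair_comm]
  · let g : Fk × Fl → U := fun x ↦ ⟨f x.1 x.2, x.1, x.1.2, x.2, x.2.2, rfl⟩
    have hg : Function.Bijective g := by
      refine ⟨fun x y hxy ↦ ?_, ?_⟩
      · have := hf_inj x.1.2 x.2.2 y.1.2 y.2.2 (congrArg Subtype.val hxy)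
        exact Prod.ext (Subtype.ext this.1) (Subtype.ext this.2)
      · rintro ⟨_, a, ha, u, hu, rfl⟩
        exact ⟨(⟨a, ha⟩, ⟨u, hu⟩), rfl⟩
    have hcard : Nat.card U = q ^ (k + l) := by
      rw [← Nat.card_congr (Equiv.ofBijective g hg), Nat.card_prod, hFk, hFl, pow_add]
    rw [Module.natCard_eq_pow_finrank (K := F), hF] at hcard
    exact Nat.pow_right_injective hq1 hcard
end

section
/- Let q be a prime power and n, k, l positive integers with kl | n and gcd(k, l) = 1. Let γ ∈ F_{q^n}^* be a root of an irreducible polynomial of degree n/(kl) over F_{q^{kl}}, where n/(kl) > 6, and let δ_1, δ_2 ∈ F_{q^k}^* and τ_1, τ_2 ∈ F_{q^l}^*. Then U = {δ_1 a + δ_2 a^q γ + τ_1 u γ^2 + τ_2 u^q γ^3 : a ∈ F_{q^k}, u ∈ F_{q^l}} is a Sidon space of F_q-dimension k + l. -/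
open Submodule Pointwise

set_option maxHeartbeats 1000000
set_option synthInstance.maxHeartbeats 400000

/-- If `a * b = c * d ≠ 0` and `a b^q + a^q b = c d^q + c^q d`, then `a` is proportional to `c` or
to `d` over the subfield fixed by `x ↦ x ^ q`. -/
lemma exists_mul_of_mul_pow_add_eq {K : Type*} [Field K] {q : ℕ} {F : Subfield K}
    (hfix : ∀ x : K, x ^ q = x → x ∈ F) {a b c d : K} (ha : a ≠ 0) (hb : b ≠ 0)
    (h0 : a * b = c * d) (h1 : a * b ^ q + a ^ q * b = c * d ^ q + c ^ q * d) :
    (∃ t ∈ F, a = t * c) ∨ ∃ t ∈ F, a = t * d := by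
  have hcd : c * d ≠ 0 := h0 ▸ mul_ne_zero ha hb
  have hc : c ≠ 0 := left_ne_zero_of_mul hcd
  have hd : d ≠ 0 := right_ne_zero_of_mul hcd
  have hpow : a ^ q * b ^ q = c ^ q * d ^ q := by rw [← mul_pow, h0, mul_pow]
  have hmul : (a * b ^ q - c * d ^ q) * (a * b ^ q - c ^ q * d) = 0 := by
    linear_combination (-a * b ^ q) * (-h1) + (c * d) * (-hpow) - (a ^ q * b ^ q) * h0
  have key : ∀ x y : K, x ≠ 0 → a * b = x * y → a * b ^ q = x * y ^ q → ∃ t ∈ F, a = t * x := by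
    intro x y hx hxy hq
    refine ⟨a / x, hfix _ ?_, by field_simp⟩
    have h2 : y / b = a / x := by field_simp; linear_combination -hxy
    have h3 : (y / b) ^ q = a / x := by
      have := pow_ne_zero q hb
      rw [div_pow]; field_simp; linear_combination -hq
    rw [← h2, h3, h2]
  rcases mul_eq_zero.1 hmul with h | h
  · exact Or.inl (key c d hc h0 (sub_eq_zero.1 h))
  · exact Or.inr (key d c hd (by rw [h0, mul_comm]) (by rw [sub_eq_zero.1 h, mul_comm]))

/-- A relation `a v = d w` between elements of two subfields is a proportionality over the
intersection of these subfields. -/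
lemma exists_mul_of_mul_eq_mul {K : Type*} [Field K] {F Fk Fl : Subfield K}
    (hinf : ∀ x ∈ Fk, x ∈ Fl → x ∈ F) {a d v w : K} (ha : a ∈ Fk) (hd : d ∈ Fk) (hv : v ∈ Fl)
    (hw : w ∈ Fl) (hd0 : d ≠ 0) (hv0 : v ≠ 0) (h : a * v = d * w) :
    ∃ t ∈ F, a = t * d ∧ w = t * v := by
  have h1 : a / d = w / v := by field_simp; linear_combination h
  exact ⟨a / d, hinf _ (div_mem ha hd) (h1 ▸ div_mem hw hv), by field_simp,
    by rw [h1]; field_simp⟩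

/-- The nondegenerate case `a b ≠ 0` of `proportional_of_coeff_eq`, given that `a` is
proportional to `c`. -/
lemma proportional_of_coeff_eq_of_eq_mul {K : Type*} [Field K] {q : ℕ} {F Fk Fl : Subfield K}
    (hfix : ∀ x : K, x ^ q = x → x ∈ F) (hinf : ∀ x ∈ Fk, x ∈ Fl → x ∈ F)
    {a b c d u v w z : K} (ha : a ∈ Fk) (hb : b ∈ Fk) (hc : c ∈ Fk) (hd : d ∈ Fk)
    (hu : u ∈ Fl) (hv : v ∈ Fl) (hw : w ∈ Fl) (hz : z ∈ Fl)
    (h0 : a * b = c * d) (h2 : a * v + b * u = c * z + d * w) (h4 : u * v = w * z)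
    (h5 : u * v ^ q + u ^ q * v = w * z ^ q + w ^ q * z)
    (ha0 : a ≠ 0) (hb0 : b ≠ 0) {t : K} (ht : t ∈ F) (hat : a = t * c) :
    (∃ s ∈ F, a = s * c ∧ u = s * w) ∨ ∃ s ∈ F, a = s * d ∧ u = s * z := by
  have hcd : c * d ≠ 0 := h0 ▸ mul_ne_zero ha0 hb0
  have hc0 : c ≠ 0 := left_ne_zero_of_mul hcd
  have hd0 : d ≠ 0 := right_ne_zero_of_mul hcd
  have ht0 : t ≠ 0 := left_ne_zero_of_mul (hat ▸ ha0)
  have hdb : d = t * b := mul_left_cancel₀ hc0 (by rw [← h0, hat]; ring)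
  by_cases hu0 : u = 0
  · by_cases hw0 : w = 0
    · exact Or.inl ⟨t, ht, hat, by simp [hu0, hw0]⟩
    · have hz0 : z = 0 := by simpa [hu0, hw0] using h4.symm
      have hav : a * v = d * w := by simpa [hu0, hz0] using h2
      have hv0 : v ≠ 0 := right_ne_zero_of_mul (hav ▸ mul_ne_zero hd0 hw0)
      obtain ⟨s, hs, h, -⟩ := exists_mul_of_mul_eq_mul hinf ha hd hv hw hd0 hv0 hav
      exact Or.inr ⟨s, hs, h, by simp [hu0, hz0]⟩
  by_cases hv0 : v = 0
  · by_cases hw0 : w = 0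
    · have hbu : b * u = c * z := by simpa [hv0, hw0] using h2
      have hz0 : z ≠ 0 := right_ne_zero_of_mul (hbu ▸ mul_ne_zero hb0 hu0)
      obtain ⟨s, hs, h, h'⟩ := exists_mul_of_mul_eq_mul hinf hc hb hz hu hb0 hz0 hbu.symm
      exact Or.inr ⟨s, hs, mul_right_cancel₀ hb0 (by rw [h0, h]; ring), h'⟩
    · have hz0 : z = 0 := by simpa [hv0, hw0] using h4.symm
      have hbu : b * u = d * w := by simpa [hv0, hz0] using h2
      exact Or.inl ⟨t, ht, hat, mul_left_cancel₀ hb0 (by rw [hbu, hdb]; ring)⟩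
  have hwz : w * z ≠ 0 := h4 ▸ mul_ne_zero hu0 hv0
  have hw0 : w ≠ 0 := left_ne_zero_of_mul hwz
  have hz0 : z ≠ 0 := right_ne_zero_of_mul hwz
  rcases exists_mul_of_mul_pow_add_eq hfix hu0 hv0 h4 h5 with ⟨s, hs, hus⟩ | ⟨s, hs, hus⟩
  · have hzv : z = s * v := mul_left_cancel₀ hw0 (by rw [← h4, hus]; ring)
    have hmul : (t - s) * (c * v - b * w) = 0 := by
      rw [hat, hus, hzv, hdb] at h2
      linear_combination h2
    rcases mul_eq_zero.1 hmul with h | h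
    · exact Or.inl ⟨t, ht, hat, by rw [sub_eq_zero.1 h, hus]⟩
    · obtain ⟨r, hr, h, h'⟩ := exists_mul_of_mul_eq_mul hinf hc hb hv hw hb0 hv0 (sub_eq_zero.1 h)
      exact Or.inr ⟨r, hr, by rw [hat, h, hdb]; ring, by rw [hus, h', hzv]; ring⟩
  · have hwv : w = s * v := mul_right_cancel₀ hz0 (by rw [← h4, hus]; ring)
    have hmul : (c - s * b) * (t * v - z) = 0 := by
      rw [hat, hus, hwv, hdb] at h2
      linear_combination h2
    rcases mul_eq_zero.1 hmul with h | h
    · exact Or.inr ⟨s, hs, by rw [hat, sub_eq_zero.1 h, hdb]; ring, hus⟩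
    · exact Or.inl ⟨t, ht, hat, by rw [hus, hwv, ← sub_eq_zero.1 h]; ring⟩

/-- The degenerate case `a b = 0` of `proportional_of_coeff_eq`, given that `c = 0`. -/
lemma proportional_of_coeff_eq_of_eq_zero {K : Type*} [Field K] {q : ℕ} {F Fk Fl : Subfield K}
    (hfix : ∀ x : K, x ^ q = x → x ∈ F) (hinf : ∀ x ∈ Fk, x ∈ Fl → x ∈ F)
    {a b c d u v w z : K} (ha : a ∈ Fk) (hb : b ∈ Fk) (hd : d ∈ Fk)
    (hu : u ∈ Fl) (hv : v ∈ Fl) (hw : w ∈ Fl)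
    (h2 : a * v + b * u = c * z + d * w) (h4 : u * v = w * z)
    (h5 : u * v ^ q + u ^ q * v = w * z ^ q + w ^ q * z)
    (hau : a ≠ 0 ∨ u ≠ 0) (hbv : b ≠ 0 ∨ v ≠ 0) (hcw : c ≠ 0 ∨ w ≠ 0)
    (hab : a * b = 0) (hc0 : c = 0) :
    (∃ s ∈ F, a = s * c ∧ u = s * w) ∨ ∃ s ∈ F, a = s * d ∧ u = s * z := by
  subst hc0
  have hw0 : w ≠ 0 := by simpa using hcw
  by_cases ha0 : a = 0
  · subst ha0
    have hu0 : u ≠ 0 := by simpa using hau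
    have hbu : b * u = d * w := by simpa using h2
    by_cases hd0 : d = 0
    · subst hd0
      have hb0 : b = 0 := by simpa [hu0] using hbu
      have hv0 : v ≠ 0 := by simpa [hb0] using hbv
      rcases exists_mul_of_mul_pow_add_eq hfix hu0 hv0 h4 h5 with ⟨s, hs, h⟩ | ⟨s, hs, h⟩
      · exact Or.inl ⟨s, hs, by simp, h⟩
      · exact Or.inr ⟨s, hs, by simp, h⟩
    · obtain ⟨t, ht, -, h⟩ := exists_mul_of_mul_eq_mul hinf hb hd hu hw hd0 hu0 hbu
      have ht0 : t ≠ 0 := left_ne_zero_of_mul (h ▸ hw0)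
      exact Or.inl ⟨t⁻¹, inv_mem ht, by simp, by rw [h]; field_simp⟩
  · have hb0 : b = 0 := by simpa [ha0] using hab
    subst hb0
    have hv0 : v ≠ 0 := by simpa using hbv
    have hav : a * v = d * w := by simpa using h2
    have hd0 : d ≠ 0 := left_ne_zero_of_mul (hav ▸ mul_ne_zero ha0 hv0)
    obtain ⟨t, ht, h, h'⟩ := exists_mul_of_mul_eq_mul hinf ha hd hv hw hd0 hv0 hav
    exact Or.inr ⟨t, ht, h, mul_right_cancel₀ hv0 (by rw [h4, h']; ring)⟩

/-- Comparing coefficients of the products of the polynomials attached to the pairs `(a, u)`,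
`(b, v)` and `(c, w)`, `(d, z)` shows that `(a, u)` is proportional to `(c, w)` or `(d, z)`. -/
lemma proportional_of_coeff_eq {K : Type*} [Field K] {q : ℕ} {F Fk Fl : Subfield K}
    (hfix : ∀ x : K, x ^ q = x → x ∈ F) (hinf : ∀ x ∈ Fk, x ∈ Fl → x ∈ F)
    {a b c d u v w z : K} (ha : a ∈ Fk) (hb : b ∈ Fk) (hc : c ∈ Fk) (hd : d ∈ Fk)
    (hu : u ∈ Fl) (hv : v ∈ Fl) (hw : w ∈ Fl) (hz : z ∈ Fl)
    (h0 : a * b = c * d) (h1 : a * b ^ q + a ^ q * b = c * d ^ q + c ^ q * d)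
    (h2 : a * v + b * u = c * z + d * w) (h4 : u * v = w * z)
    (h5 : u * v ^ q + u ^ q * v = w * z ^ q + w ^ q * z)
    (hau : a ≠ 0 ∨ u ≠ 0) (hbv : b ≠ 0 ∨ v ≠ 0) (hcw : c ≠ 0 ∨ w ≠ 0) (hdz : d ≠ 0 ∨ z ≠ 0) :
    (∃ s ∈ F, a = s * c ∧ u = s * w) ∨ ∃ s ∈ F, a = s * d ∧ u = s * z := by
  have h0' : a * b = d * c := by rw [h0, mul_comm]
  have h2' : a * v + b * u = d * w + c * z := by rw [h2, add_comm]
  have h4' : u * v = z * w := by rw [h4, mul_comm]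
  have h5' : u * v ^ q + u ^ q * v = z * w ^ q + z ^ q * w := by rw [h5]; ring
  by_cases hab : a * b = 0
  · rcases mul_eq_zero.1 (h0.symm.trans hab) with h | h
    · exact proportional_of_coeff_eq_of_eq_zero hfix hinf ha hb hd hu hv hw h2 h4 h5
        hau hbv hcw hab h
    · exact (proportional_of_coeff_eq_of_eq_zero hfix hinf ha hb hc hu hv hz h2' h4' h5'
        hau hbv hdz hab h).symm
  · have ha0 := left_ne_zero_of_mul hab
    have hb0 := right_ne_zero_of_mul hab
    rcases exists_mul_of_mul_pow_add_eq hfix ha0 hb0 h0 h1 with ⟨t, ht, h⟩ | ⟨t, ht, h⟩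
    · exact proportional_of_coeff_eq_of_eq_mul hfix hinf ha hb hc hd hu hv hw hz h0 h2 h4 h5
        ha0 hb0 ht h
    · exact (proportional_of_coeff_eq_of_eq_mul hfix hinf ha hb hd hc hu hv hz hw h0' h2' h4' h5'
        ha0 hb0 ht h).symm

/-- In a nonzero equality of products `x y = x' y'`, if `x` is a multiple of `x'` then the two
pairs span the same lines. -/
lemma span_pair_eq_of_eq_mul {K : Type*} [Field K] {F : Subfield K} {x y x' y' s : K}
    (hx : x ≠ 0) (hx' : x' ≠ 0) (h : x * y = x' * y') (hs : s ∈ F) (hxs : x = s * x') :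
    ({span F {x}, span F {y}} : Set (Submodule F K)) = {span F {x'}, span F {y'}} := by
  have hs0 : s ≠ 0 := left_ne_zero_of_mul (hxs ▸ hx)
  have hu : IsUnit (⟨s, hs⟩ : F) := isUnit_iff_ne_zero.2 fun h => hs0 (congrArg Subtype.val h)
  have hy : y' = s * y := mul_left_cancel₀ hx' (by rw [← h, hxs]; ring)
  have h1 : span F {x} = span F {x'} := by
    rw [hxs]; exact span_singleton_smul_eq hu x'
  have h2 : span F {y'} = span F {y} := by
    rw [hy]; exact span_singleton_smul_eq hu y
  rw [h1, h2]

/-- Elements of a subfield of order `q ^ k` are periodic of period `k` under `x ↦ x ^ q`. -/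
lemma Subfield.isPeriodicPt_pow {K : Type*} [Field K] {q k : ℕ} (L : Subfield K) (hq : q ≠ 0)
    (hL : Nat.card L = q ^ k) {x : K} (hx : x ∈ L) :
    Function.IsPeriodicPt (fun y : K => y ^ q) k x := by
  have : Finite L := Nat.finite_of_card_ne_zero (hL ▸ pow_ne_zero k hq)
  have : Fintype L := Fintype.ofFinite L
  have h := congrArg Subtype.val (FiniteField.pow_card (⟨x, hx⟩ : L))
  rw [Fintype.card_eq_nat_card, hL] at h
  simpa [Function.IsPeriodicPt, Function.IsFixedPt, pow_iterate] using h

/-- A subfield of order `q` contains all fixed points of `x ↦ x ^ q`. -/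
lemma Subfield.mem_of_pow_eq {K : Type*} [Field K] {q : ℕ} (F : Subfield K) (hq : 1 < q)
    (hF : Nat.card F = q) {x : K} (hx : x ^ q = x) : x ∈ F := by
  classical
  have : Finite F := Nat.finite_of_card_ne_zero (by omega)
  have hne : (Polynomial.X ^ q - Polynomial.X : Polynomial K) ≠ 0 :=
    FiniteField.X_pow_card_sub_X_ne_zero K hq
  set R := (Polynomial.X ^ q - Polynomial.X : Polynomial K).roots.toFinset with hR
  have hmem : ∀ y : K, y ∈ R ↔ y ^ q = y := fun y => by
    simp [hR, Polynomial.mem_roots hne, sub_eq_zero]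
  have hsub : (F : Set K) ⊆ R := fun y hy => (hmem y).2 <| by
    have := F.isPeriodicPt_pow (k := 1) (q := q) (by omega) (by simpa using hF) hy
    simpa [Function.IsPeriodicPt, Function.IsFixedPt] using this
  have hcard : (R : Set K).ncard ≤ (F : Set K).ncard := by
    rw [Set.ncard_coe_finset]
    calc R.card ≤ _ := Multiset.toFinset_card_le _
      _ ≤ _ := Polynomial.card_roots' _
      _ = q := FiniteField.X_pow_card_sub_X_natDegree_eq K hq
      _ = _ := hF.symm
  have := Set.eq_of_subset_of_ncard_le hsub hcard
  exact (this ▸ (hmem x).2 hx : x ∈ (F : Set K))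

/-- Over a subfield, the powers `1, γ, …, γ ^ 6` of an element of degree more than `6` are
linearly independent. -/
lemma coeff_eq_zero_of_six_lt_natDegree_minpoly {K : Type*} [Field K] {L : Subfield K} {γ : K}
    (h6 : 6 < (minpoly L γ).natDegree) {f : Fin 7 → K} (hf : ∀ i, f i ∈ L)
    (h : ∑ i, f i * γ ^ (i : ℕ) = 0) (i : Fin 7) : f i = 0 := by
  have hli := (linearIndependent_pow (K := L) γ).comp (Fin.castLE h6) (Fin.castLE_injective h6)
  have := Fintype.linearIndependent_iff.1 hli (fun i => ⟨f i, hf i⟩) h i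
  exact congrArg Subtype.val this

/-- The set `{δ₁a + δ₂aᑫγ + τ₁uγ² + τ₂uᑫγ³}` is closed under linear combinations over the fixed
field of `x ↦ x ^ q`. -/
lemma coe_span_frobenius_family {K : Type*} [Field K] {q : ℕ} {F Fk Fl : Subfield K}
    (φ : K →+* K) (hφ : ∀ x, φ x = x ^ q) (hF : ∀ x ∈ F, x ^ q = x) (hFFk : F ≤ Fk) (hFFl : F ≤ Fl)
    (γ δ₁ δ₂ τ₁ τ₂ : K) :
    (span F {x : K | ∃ a ∈ Fk, ∃ u ∈ Fl,
        x = δ₁ * a + δ₂ * a ^ q * γ + τ₁ * u * γ ^ 2 + τ₂ * u ^ q * γ ^ 3} : Set K) =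
      {x : K | ∃ a ∈ Fk, ∃ u ∈ Fl,
        x = δ₁ * a + δ₂ * a ^ q * γ + τ₁ * u * γ ^ 2 + τ₂ * u ^ q * γ ^ 3} := by
  simp only [← hφ] at hF ⊢
  refine subset_antisymm (fun x hx => ?_) subset_span
  induction hx using span_induction with
  | mem x h => exact h
  | zero => exact ⟨0, zero_mem _, 0, zero_mem _, by simp⟩
  | add x y _ _ hx hy =>
    obtain ⟨a, ha, u, hu, rfl⟩ := hx
    obtain ⟨b, hb, v, hv, rfl⟩ := hy
    exact ⟨a + b, add_mem ha hb, u + v, add_mem hu hv, by simp only [map_add]; ring⟩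
  | smul r x _ hx =>
    obtain ⟨a, ha, u, hu, rfl⟩ := hx
    refine ⟨r * a, mul_mem (hFFk r.2) ha, r * u, mul_mem (hFFl r.2) hu, ?_⟩
    rw [map_mul, map_mul, hF r r.2]
    simp only [Subfield.smul_def, smul_eq_mul]
    ring

/-- For `kl ∣ n`, `gcd(k,l) = 1`, `γ` a root of an irreducible polynomial of
degree `n/(kl) > 6` over `F_{q^{kl}}`, `δ₁, δ₂ ∈ F_{q^k}^*`, `τ₁, τ₂ ∈ F_{q^l}^*`, the set
`U = {δ₁a + δ₂aᑫγ + τ₁uγ² + τ₂uᑫγ³ : a ∈ F_{q^k}, u ∈ F_{q^l}}` is a Sidon space of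
dimension `k + l`. -/
theorem sidonSpace_sum_two_nontrivial' {K : Type*} [Field K] (q n k l : ℕ)
    (hq : IsPrimePow q) (hn : 0 < n) (hk : 0 < k) (hl : 0 < l)
    (hkl : Nat.Coprime k l) (hkln : k * l ∣ n)
    (hK : Nat.card K = q ^ n)
    (F : Subfield K) (hF : Nat.card F = q)
    (Fk : Subfield K) (hFk : Nat.card Fk = q ^ k) (hFFk : F ≤ Fk)
    (Fl : Subfield K) (hFl : Nat.card Fl = q ^ l) (hFFl : F ≤ Fl)
    (Fkl : Subfield K) (hFkl : Nat.card Fkl = q ^ (k * l))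
    (hFkFkl : Fk ≤ Fkl) (hFlFkl : Fl ≤ Fkl)
    (γ : K) (hγ : γ ≠ 0)
    (hdeg : (minpoly Fkl γ).natDegree = n / (k * l)) (hdeg6 : 6 < n / (k * l))
    (δ₁ δ₂ : K) (hδ₁ : δ₁ ∈ Fk) (hδ₂ : δ₂ ∈ Fk) (hδ₁0 : δ₁ ≠ 0) (hδ₂0 : δ₂ ≠ 0)
    (τ₁ τ₂ : K) (hτ₁ : τ₁ ∈ Fl) (hτ₂ : τ₂ ∈ Fl) (hτ₁0 : τ₁ ≠ 0) (hτ₂0 : τ₂ ≠ 0) :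
    IsSidonSpace F
        (Submodule.span F
          {x : K | ∃ a ∈ Fk, ∃ u ∈ Fl,
            x = δ₁ * a + δ₂ * a ^ q * γ + τ₁ * u * γ ^ 2 + τ₂ * u ^ q * γ ^ 3}) ∧
      Module.finrank F
        ↥(Submodule.span F
          {x : K | ∃ a ∈ Fk, ∃ u ∈ Fl,
            x = δ₁ * a + δ₂ * a ^ q * γ + τ₁ * u * γ ^ 2 + τ₂ * u ^ q * γ ^ 3}) = k + l := by
  have hq1 : 1 < q := hq.one_lt
  have : Finite F := Nat.finite_of_card_ne_zero (by omega)
  have : Finite K := Nat.finite_of_card_ne_zero (by rw [hK]; positivity)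
  have : Fintype F := Fintype.ofFinite F
  have hfix : ∀ x : K, x ^ q = x → x ∈ F := fun x => F.mem_of_pow_eq hq1 hF
  have hFpow : ∀ x ∈ F, x ^ q = x := fun x hx => by
    simpa [Function.IsPeriodicPt, Function.IsFixedPt] using
      F.isPeriodicPt_pow (k := 1) (by omega) (by simpa using hF) hx
  have hinf : ∀ x ∈ Fk, x ∈ Fl → x ∈ F := fun x hxk hxl => hfix x <| by
    have := (Fk.isPeriodicPt_pow (by omega) hFk hxk).gcd (Fl.isPeriodicPt_pow (by omega) hFl hxl)
    rw [hkl.gcd_eq_one] at this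
    simpa [Function.IsPeriodicPt, Function.IsFixedPt] using this
  obtain ⟨φ, hφ⟩ : ∃ φ : K →+* K, ∀ x, φ x = x ^ q :=
    ⟨(FiniteField.frobeniusAlgHom F K : K →+* K), fun x => by
      simp [← hF]⟩
  have hS := coe_span_frobenius_family φ hφ hFpow hFFk hFFl γ δ₁ δ₂ τ₁ τ₂
  have hcoeff := fun f => coeff_eq_zero_of_six_lt_natDegree_minpoly (f := f) (hdeg ▸ hdeg6)
  refine ⟨?_, ?_⟩
  · have hne : ∀ a u : K, δ₁ * a + δ₂ * a ^ q * γ + τ₁ * u * γ ^ 2 + τ₂ * u ^ q * γ ^ 3 ≠ 0 →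
        a ≠ 0 ∨ u ≠ 0 := by
      intro a u h
      by_contra! h'
      exact h (by simp [h'.1, h'.2, zero_pow hq1.ne_bot])
    intro x hx y hy x' hx' y' hy' hx0 hy0 hx'0 hy'0 hxy
    rw [← SetLike.mem_coe, hS] at hx hy hx' hy'
    obtain ⟨a, ha, u, hu, hx⟩ := hx
    obtain ⟨b, hb, v, hv, hy⟩ := hy
    obtain ⟨c, hc, w, hw, hx'⟩ := hx'
    obtain ⟨d, hd, z, hz, hy'⟩ := hy'
    have := hcoeff
      ![δ₁ ^ 2 * (a * b - c * d),
        δ₁ * δ₂ * (a * b ^ q + a ^ q * b - (c * d ^ q + c ^ q * d)),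
        δ₂ ^ 2 * ((a * b) ^ q - (c * d) ^ q) + δ₁ * τ₁ * (a * v + b * u - (c * z + d * w)),
        δ₁ * τ₂ * (a * v ^ q + b * u ^ q - (c * z ^ q + d * w ^ q)) +
          δ₂ * τ₁ * (a ^ q * v + b ^ q * u - (c ^ q * z + d ^ q * w)),
        δ₂ * τ₂ * (a ^ q * v ^ q + b ^ q * u ^ q - (c ^ q * z ^ q + d ^ q * w ^ q)) +
          τ₁ ^ 2 * (u * v - w * z),
        τ₁ * τ₂ * (u * v ^ q + u ^ q * v - (w * z ^ q + w ^ q * z)),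
        τ₂ ^ 2 * ((u * v) ^ q - (w * z) ^ q)]
      (by
        replace ha := hFkFkl ha
        replace hb := hFkFkl hb
        replace hc := hFkFkl hc
        replace hd := hFkFkl hd
        replace hu := hFlFkl hu
        replace hv := hFlFkl hv
        replace hw := hFlFkl hw
        replace hz := hFlFkl hz
        replace hδ₁ := hFkFkl hδ₁
        replace hδ₂ := hFkFkl hδ₂
        replace hτ₁ := hFlFkl hτ₁
        replace hτ₂ := hFlFkl hτ₂
        intro i
        fin_cases i <;> dsimp <;>
          repeat' first
            | assumption | apply sub_mem | apply add_mem | apply mul_mem | apply pow_mem)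
      (by
        rw [hx, hy, hx', hy'] at hxy
        simp [Fin.sum_univ_succ, mul_pow]
        linear_combination hxy)
    have e0 := this 0
    have e1 := this 1
    have e2 := this 2
    have e4 := this 4
    have e5 := this 5
    simp [hδ₁0, hδ₂0, hτ₁0, hτ₂0] at e0 e1 e2 e4 e5
    have h0 := sub_eq_zero.1 e0
    have h1 := sub_eq_zero.1 e1
    have h5 := sub_eq_zero.1 e5
    have h2 : a * v + b * u = c * z + d * w := by
      simpa [h0, hδ₁0, hτ₁0, sub_eq_zero] using e2
    have h4 : u * v = w * z := by
      have := congrArg φ h2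
      simp only [map_add, map_mul] at this
      simp only [hφ] at this
      simpa [this, hτ₁0, sub_eq_zero] using e4
    rcases proportional_of_coeff_eq hfix hinf ha hb hc hd hu hv hw hz h0 h1 h2 h4 h5
      (hne _ _ (hx ▸ hx0)) (hne _ _ (hy ▸ hy0)) (hne _ _ (hx' ▸ hx'0)) (hne _ _ (hy' ▸ hy'0))
      with ⟨s, hs, has, hus⟩ | ⟨s, hs, has, hus⟩
    · refine span_pair_eq_of_eq_mul hx0 hx'0 hxy hs ?_
      rw [hx, hx', has, hus, mul_pow, mul_pow, hFpow s hs]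
      ring
    · rw [Set.pair_comm (span F {x'})]
      refine span_pair_eq_of_eq_mul hx0 hy'0 (by rw [hxy, mul_comm]) hs ?_
      rw [hx, hy', has, hus, mul_pow, mul_pow, hFpow s hs]
      ring
  · refine Nat.pow_right_injective hq1 ?_
    have hbij : Function.Bijective (fun p : Fk × Fl =>
        (⟨δ₁ * p.1 + δ₂ * p.1 ^ q * γ + τ₁ * p.2 * γ ^ 2 + τ₂ * p.2 ^ q * γ ^ 3,
          subset_span ⟨p.1, p.1.2, p.2, p.2.2, rfl⟩⟩ : span F {x : K | ∃ a ∈ Fk, ∃ u ∈ Fl,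
            x = δ₁ * a + δ₂ * a ^ q * γ + τ₁ * u * γ ^ 2 + τ₂ * u ^ q * γ ^ 3})) := by
      constructor
      · rintro ⟨⟨a, ha⟩, ⟨u, hu⟩⟩ ⟨⟨b, hb⟩, ⟨v, hv⟩⟩ h
        replace h := congrArg Subtype.val h
        dsimp only at h
        have := hcoeff ![δ₁ * (a - b), δ₂ * (a ^ q - b ^ q), τ₁ * (u - v),
            τ₂ * (u ^ q - v ^ q), 0, 0, 0]
          (by
            replace ha := hFkFkl ha
            replace hb := hFkFkl hb
            replace hu := hFlFkl hu
            replace hv := hFlFkl hv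
            replace hδ₁ := hFkFkl hδ₁
            replace hδ₂ := hFkFkl hδ₂
            replace hτ₁ := hFlFkl hτ₁
            replace hτ₂ := hFlFkl hτ₂
            intro i
            fin_cases i <;> dsimp <;>
              repeat' first
                | assumption | apply sub_mem | apply mul_mem | apply pow_mem | apply zero_mem)
          (by
            simp [Fin.sum_univ_succ]
            linear_combination h)
        have e0 := this 0
        have e2 := this 2
        simp [hδ₁0, hτ₁0, sub_eq_zero] at e0 e2
        simp [e0, e2]
      · rintro ⟨x, hx⟩
        obtain ⟨a, ha, u, hu, rfl⟩ := hS.subset hx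
        exact ⟨(⟨a, ha⟩, ⟨u, hu⟩), rfl⟩
    have hcard := Nat.card_congr (Equiv.ofBijective _ hbij)
    rw [Nat.card_prod, hFk, hFl, Module.natCard_eq_pow_finrank (K := F), hF, ← pow_add] at hcard
    exact hcard.symm
end
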